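/- There exists a function f : ℕ → ℕ such that the following holds. Let A be a finite group isomorphic to the dihedral group D₈ of order 8, let V ≤ A be a subgroup isomorphic to the Klein four-group, and let α be an involution in A \ V (so that A = V⟨α⟩). Suppose A acts by automorphisms on a finite group G in such a manner that C_G(V) = 1 and the centralizer C_G(α) has exponent dividing e. Then the exponent of the derived subgroup G′ of G is at most f(e). -/

import Mathlib

namespace D8P

/-! ### Square roots in groups of odd order -/
section odd

variable {G : Type*} [Group G]

/-- square root in a group of odd order -/
noncomputable def sq (g : G) : G := g ^ ((Nat.card G + 1) / 2)

theorem sq_mul_self [Finite G] (ho : Odd (Nat.card G)) (g : G) : sq g * sq g = g := by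
  unfold sq
  obtain ⟨k, hk⟩ := ho
  rw [← pow_add]
  have : (Nat.card G + 1) / 2 + (Nat.card G + 1) / 2 = Nat.card G + 1 := by omega
  rw [this, pow_succ, pow_card_eq_one', one_mul]

theorem sq_uniq [Finite G] (ho : Odd (Nat.card G)) {u w : G} (h : u * u = w) : sq w = u := by
  unfold sq
  obtain ⟨k, hk⟩ := ho
  subst h
  rw [← pow_two, ← pow_mul]
  have : 2 * ((Nat.card G + 1) / 2) = Nat.card G + 1 := by omega
  rw [this, pow_succ, pow_card_eq_one', one_mul]

theorem sq_inj [Finite G] (ho : Odd (Nat.card G)) {u w : G} (h : u * u = w * w) : u = w := by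
  rw [← sq_uniq ho h, sq_uniq ho rfl]

theorem eq_one_of_sq [Finite G] (ho : Odd (Nat.card G)) {u : G} (h : u * u = 1) : u = 1 :=
  sq_inj ho (by simpa using h)

theorem sq_map (f : G →* G) (g : G) : f (sq g) = sq (f g) := by
  simp [sq]

theorem sq_inv (g : G) : sq g⁻¹ = (sq g)⁻¹ := by
  simp [sq]

theorem sq_mem {H : Subgroup G} {g : G} (h : g ∈ H) : sq g ∈ H := H.pow_mem h _

theorem sq_pow {g : G} {n : ℕ} (h : g ^ n = 1) : sq g ^ n = 1 := by
  unfold sq; rw [← pow_mul, mul_comm, pow_mul, h, one_pow]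

variable [Finite G] (ho : Odd (Nat.card G))
include ho

theorem dec (σ : G →* G) (h2 : ∀ x, σ (σ x) = x) (g : G) :
    ∃ u c, g = u * c ∧ σ u = u⁻¹ ∧ σ c = c ∧ u = sq (g * (σ g)⁻¹) := by
  have hu : σ (sq (g * (σ g)⁻¹)) = (sq (g * (σ g)⁻¹))⁻¹ := by
    rw [sq_map, ← sq_inv]; simp [h2]
  refine ⟨sq (g * (σ g)⁻¹), (sq (g * (σ g)⁻¹))⁻¹ * g, by group, hu, ?_, rfl⟩
  rw [map_mul, map_inv, hu, inv_inv]
  have := sq_mul_self ho (g * (σ g)⁻¹)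
  set u := sq (g * (σ g)⁻¹)
  have h3 : σ g = u⁻¹ * (u⁻¹ * g) := by
    rw [← mul_assoc, ← mul_inv_rev, this]; group
  rw [h3]; group

theorem inv_of_fix_pt {c i j : G} (h : c * i * c = j) (w : G) (h' : w * i * w = j) : c = w := by
  -- write i = r * r ; (r c r)^2 = r j r
  obtain ⟨r, rfl⟩ : ∃ r, i = r * r := ⟨sq i, (sq_mul_self ho i).symm⟩
  have : (r * c * r) * (r * c * r) = (r * w * r) * (r * w * r) := by
    have e1 : (r * c * r) * (r * c * r) = r * (c * (r * r) * c) * r := by group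
    have e2 : (r * w * r) * (r * w * r) = r * (w * (r * r) * w) * r := by group
    rw [e1, e2, h, h']
  have := sq_inj ho this
  simpa using this

theorem DL (σ τ : G →* G) (hs : ∀ x, σ (σ x) = x) (ht : ∀ x, τ (τ x) = x)
    (hc : ∀ x, σ (τ x) = τ (σ x)) (i : G) (hi : σ i = i⁻¹) :
    ∃ D f, i = D * f * D ∧ σ D = D⁻¹ ∧ τ D = D ∧ σ f = f⁻¹ ∧ τ f = f⁻¹ := by
  set r := sq i with hr
  have hrr : r * r = i := sq_mul_self ho i
  set j := τ i with hj
  set t := sq (r⁻¹ * j * r⁻¹) with ht'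
  have htt : t * t = r⁻¹ * j * r⁻¹ := sq_mul_self ho _
  set c := r * t * r with hcdef
  -- c * i⁻¹ * c = j
  have hcj : c * i⁻¹ * c = j := by
    have : c * i⁻¹ * c = r * (t * t) * r := by rw [hcdef, ← hrr]; group
    rw [this, htt]; group
  have hcj' : c * j⁻¹ * c = i := by
    rw [← hcj]; group
  have hτc : τ c = c := by
    refine (inv_of_fix_pt ho hcj' (τ c) ?_).symm
    have := congrArg τ hcj
    rw [map_mul, map_mul, map_inv, ← hj, hj, ht] at this
    exact this
  have hσr : σ r = r⁻¹ := by rw [hr, sq_map, hi, sq_inv]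
  have hσj : σ j = j⁻¹ := by rw [hj, hc, hi, map_inv]
  have hσc : σ c = c⁻¹ := by
    refine inv_of_fix_pt ho (i := i) (j := j⁻¹) ?_ _ ?_
    · have := congrArg σ hcj
      rwa [map_mul, map_mul, map_inv, hi, hσj, inv_inv] at this
    · rw [← hcj]; group
  have hDD : sq c * sq c = c := sq_mul_self ho c
  have hσD : σ (sq c) = (sq c)⁻¹ := by rw [sq_map, hσc, sq_inv]
  have hτD : τ (sq c) = sq c := by rw [sq_map, hτc]
  refine ⟨sq c, (sq c)⁻¹ * i * (sq c)⁻¹, by group, hσD, hτD, ?_, ?_⟩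
  · simp [hσD, hi, mul_assoc]
  · simp only [map_mul, map_inv, hτD, ← hj]
    rw [← hcj]
    clear_value c
    generalize sq c = d at *
    subst hDD
    group

theorem DL' (σ τ : G →* G) (hs : ∀ x, σ (σ x) = x) (ht : ∀ x, τ (τ x) = x)
    (hc : ∀ x, σ (τ x) = τ (σ x)) (h : G) :
    ∃ D f m, h = D * f * m ∧ σ D = D⁻¹ ∧ τ D = D ∧ σ f = f⁻¹ ∧ τ f = f⁻¹ ∧ σ m = m := by
  obtain ⟨D, f, hi, h1, h2, h3, h4⟩ := DL ho σ τ hs ht hc (h * (σ h)⁻¹) (by simp [hs])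
  have hff : sq f * sq f = f := sq_mul_self ho f
  have hσf : σ (sq f) = (sq f)⁻¹ := by rw [sq_map, h3, sq_inv]
  refine ⟨D, sq f, (sq f)⁻¹ * D⁻¹ * h, by group, h1, h2, hσf, by rw [sq_map, h4, sq_inv], ?_⟩
  simp only [map_mul, map_inv, hσf, h1, inv_inv]
  have : σ h = (D * f * D)⁻¹ * h := by rw [← hi]; group
  rw [this]
  generalize sq f = d at *
  subst hff
  group

end odd

/-! ### The D8 structure -/

/-- an action of the dihedral group of order 8 such that the four-group is fixed-point-free -/
structure D8S (G : Type*) [Group G] where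
  a : G →* G
  b : G →* G
  s : G →* G
  aa : ∀ x, a (a x) = x
  bb : ∀ x, b (b x) = x
  ss : ∀ x, s (s x) = x
  ab : ∀ x, a (b x) = b (a x)
  sa : ∀ x, s (a x) = b (s x)
  fix : ∀ x, a x = x → b x = x → x = 1

namespace D8S
variable {G : Type*} [Group G] (D : D8S G)

/-- the central involution -/
def z : G →* G := D.a.comp D.b

theorem z_def (x : G) : D.z x = D.a (D.b x) := rfl
theorem zz (x : G) : D.z (D.z x) = x := by simp [z_def, D.ab, D.aa, D.bb]
theorem sb (x : G) : D.s (D.b x) = D.a (D.s x) := by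
  rw [← D.ss (D.a (D.s x)), D.sa, D.ss]
theorem sz (x : G) : D.s (D.z x) = D.z (D.s x) := by
  simp [z_def, D.sa, D.sb, D.ab]
theorem az (x : G) : D.a (D.z x) = D.b x := by simp [z_def, D.aa]
theorem za (x : G) : D.z (D.a x) = D.b x := by simp [z_def, ← D.ab, D.aa]
theorem bz (x : G) : D.b (D.z x) = D.a x := by simp [z_def, ← D.ab, D.bb]
theorem zb (x : G) : D.z (D.b x) = D.a x := by simp [z_def, D.bb]

/-- swapping the two non-central involutions -/
def swap : D8S G where
  a := D.b
  b := D.a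
  s := D.s
  aa := D.bb
  bb := D.aa
  ss := D.ss
  ab := fun x => (D.ab x).symm
  sa := D.sb
  fix := fun x h1 h2 => D.fix x h2 h1

theorem swap_z (x : G) : D.swap.z x = D.z x := (D.ab x).symm

variable [Finite G] (ho : Odd (Nat.card G))
include ho

/-- general fact: fixed points of one involution are inverted by another -/
theorem inv_aux (σ τ : G →* G) (h2 : ∀ x, τ (τ x) = x) 
    (hc : ∀ x, σ (τ x) = τ (σ x)) (hf : ∀ x, σ x = x → τ x = x → x = 1) (x : G) (hx : σ x = x) :
    τ x = x⁻¹ := by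
  obtain ⟨u, c, hg, hu, hcc, hu'⟩ := dec ho τ h2 x
  have hσu : σ u = u := by rw [hu', sq_map, map_mul, map_inv, hc, hx]
  have hσc : σ c = c := by
    have : c = u⁻¹ * x := by rw [hg]; group
    rw [this, map_mul, map_inv, hσu, hx]
  have := hf c hσc hcc
  rw [hg, this, mul_one, hu]

theorem a_z (x : G) (h : D.z x = x) : D.a x = x⁻¹ := by
  refine inv_aux ho D.z D.a D.aa (fun x => by rw [D.az, D.za]) ?_ x h
  intro x h1 h2
  exact D.fix x h2 (by rw [D.z_def, D.ab, h2] at h1; exact h1)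
theorem b_z (x : G) (h : D.z x = x) : D.b x = x⁻¹ := by
  rw [← D.az, h]; exact D.a_z ho x h
theorem b_a (x : G) (h : D.a x = x) : D.b x = x⁻¹ := by
  exact inv_aux ho D.a D.b D.bb D.ab D.fix x h
theorem z_a (x : G) (h : D.a x = x) : D.z x = x⁻¹ := by
  rw [D.z_def, D.b_a ho x h, map_inv, h]
theorem a_b (x : G) (h : D.b x = x) : D.a x = x⁻¹ := D.swap.b_a ho x h
theorem z_b (x : G) (h : D.b x = x) : D.z x = x⁻¹ := by
  rw [D.z_def, h, D.a_b ho x h]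

theorem comm_z (x y : G) (h : D.z x = x) (h' : D.z y = y) : x * y = y * x := by
  have := D.a_z ho (x * y) (by rw [map_mul, h, h'])
  rw [map_mul, D.a_z ho x h, D.a_z ho y h', mul_inv_rev] at this
  have := congrArg (·⁻¹) this
  simp only [mul_inv_rev, inv_inv] at this
  exact this.symm
theorem comm_a (x y : G) (h : D.a x = x) (h' : D.a y = y) : x * y = y * x := by
  have := D.b_a ho (x * y) (by rw [map_mul, h, h'])
  rw [map_mul, D.b_a ho x h, D.b_a ho y h', mul_inv_rev] at this
  have := congrArg (·⁻¹) this
  simp only [mul_inv_rev, inv_inv] at this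
  exact this.symm
theorem comm_b (x y : G) (h : D.b x = x) (h' : D.b y = y) : x * y = y * x :=
  D.swap.comm_a ho x y h h'

theorem Iz (i : G) (hi : D.z i = i⁻¹) : ∃ x y, i = x * y * x ∧ D.a x = x ∧ D.b y = y := by
  obtain ⟨x, y, h, h1, h2, h3, h4⟩ := DL ho D.z D.a D.zz D.aa (fun x => by rw [D.az, D.za]) i hi
  refine ⟨x, y, h, h2, ?_⟩
  rw [← D.az, h3, map_inv, h4, inv_inv]

/-- every element is `x * y * m`. -/
theorem xym (h : G) : ∃ x y m, h = x * y * m ∧ D.a x = x ∧ D.b y = y ∧ D.z m = m := by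
  obtain ⟨x, y, m, h, h1, h2, h3, h4, h5⟩ :=
    DL' ho D.z D.a D.zz D.aa (fun x => by rw [D.az, D.za]) h
  refine ⟨x, y, m, h, h2, ?_, h5⟩
  rw [← D.az, h3, map_inv, h4, inv_inv]

end D8S
end D8P


namespace D8P

theorem frob {E : Type*} [Ring E] {p : ℕ} (hp : p.Prime) (h0 : (p : E) = 0) (k : ℕ) {x y : E}
    (h : Commute x y) : (x + y) ^ p ^ k = x ^ p ^ k + y ^ p ^ k := by
  rcases subsingleton_or_nontrivial E with hs | hn
  · exact Subsingleton.elim _ _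
  · have : CharP E p := (CharP.charP_iff_prime_eq_zero hp).mpr h0
    have : Fact p.Prime := ⟨hp⟩
    exact add_pow_char_pow_of_commute p k h

theorem two_unit {E : Type*} [Ring E] {p : ℕ} (hp : Odd p) (h0 : (p : E) = 0) :
    IsUnit (2 : E) := by
  obtain ⟨k, rfl⟩ := hp
  push_cast at h0
  have h1 : (2 : E) * (-k) = 1 := by
    have : (2 : E) * (-k) = 1 - (2 * k + 1) := by noncomm_ring
    rw [this, h0, sub_zero]
  have h2 : (-k : E) * 2 = 1 := by
    have : (-k : E) * 2 = 1 - (2 * k + 1) := by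
      rw [neg_mul, (Nat.cast_commute k (2:E)).eq]; noncomm_ring
    rw [this, h0, sub_zero]
  exact ⟨⟨2, -k, h1, h2⟩, rfl⟩

/-- functional equations satisfied by the `π ρ(g) π` functions -/
structure Fun {G : Type*} [Group G] (D : D8S G) (p : ℕ) {R : Type*} [CommRing R] (T : G → R) :
    Prop where
  one : T 1 = 1
  mul : ∀ g h, 2 * (T g * T h) = T (g * h) + T (g * D.z h)
  inv : ∀ g, T g⁻¹ = T g
  rm : ∀ g m, D.z m = m → T (g * m) = T g
  lm : ∀ g m, D.z m = m → T (m * g) = T g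
  ta : ∀ g, T (D.a g) = T g
  tb : ∀ g, T (D.b g) = T g
  sta : ∀ g x h, D.a x = x → T (g * x * h) - T (g * x * D.a h) = T (g * h) - T (g * D.a h)
  stb : ∀ g y h, D.b y = y → T (g * y * h) - T (g * y * D.b h) = T (g * h) - T (g * D.b h)
  nil : ∀ k c, D.z c = c⁻¹ → c ^ p ^ k = 1 → (T c - 1) ^ p ^ k = 0

namespace Fun
variable {G : Type*} [Group G] {D : D8S G} {p : ℕ} {R : Type*} [CommRing R] {T : G → R}
  (F : Fun D p T) [Finite G] (ho : Odd (Nat.card G)) (h2 : IsUnit (2 : R))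
include F ho h2

theorem xy (x y : G) (hx : D.a x = x) (hy : D.b y = y) : T (x * y) = T x * T y := by
  have h := F.mul x y
  rw [D.z_b ho y hy] at h
  have h' : T (x * y⁻¹) = T (x * y) := by
    rw [← F.ta, map_mul, hx, map_inv, D.a_b ho y hy, inv_inv]
  rw [h'] at h
  apply h2.mul_left_cancel
  linear_combination -h

omit [Finite G] ho h2 in
theorem x2 (x : G) (hx : D.z x = x⁻¹) : T (x * x) = 2 * T x ^ 2 - 1 := by
  have h := F.mul x x
  rw [hx, mul_inv_cancel, F.one] at h
  linear_combination -h

theorem yxy (x y : G) (hx : D.a x = x) (hy : D.b y = y) :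
    T (y⁻¹ * x * y) = T y ^ 2 * T x - T y ^ 2 + 1 := by
  have hza := D.z_a ho x hx
  have hzb := D.z_b ho y hy
  have hab := D.a_b ho y hy
  have e1 := F.sta y⁻¹ x y hx
  rw [hab, inv_mul_cancel, F.one] at e1
  have e2 : T (y⁻¹ * y⁻¹) = 2 * T y ^ 2 - 1 := by
    rw [F.x2 y⁻¹ (by rw [map_inv, hzb]), F.inv]
  have e3 := F.mul (y⁻¹ * x) y
  rw [hzb] at e3
  have e4 : T (y⁻¹ * x) = T x * T y := by
    rw [← F.inv, mul_inv_rev, inv_inv, F.xy ho h2 x⁻¹ y (by rw [map_inv, hx]) hy, F.inv]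
  rw [e4] at e3
  rw [e2] at e1
  apply h2.mul_left_cancel
  linear_combination e1 - e3

theorem comm (x y : G) (hx : D.a x = x) (hy : D.b y = y) :
    T (x⁻¹ * y⁻¹ * (x * y)) =
      T x ^ 2 * T y ^ 2 - T x * T y ^ 2 + T x + T y - T x ^ 2 * T y := by
  have hza := D.z_a ho x hx
  have hzb := D.z_b ho y hy
  have hab := D.a_b ho y hy
  have hba := D.b_a ho x hx
  have e1 := F.stb x⁻¹ y⁻¹ (x * y) (by rw [map_inv, hy])
  rw [map_mul, hba, hy, inv_mul_cancel_left, ← mul_assoc x⁻¹ x⁻¹ y,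
    F.xy ho h2 (x⁻¹ * x⁻¹) y (by simp [hx]) hy, F.x2 x⁻¹ (by rw [map_inv, hza]), F.inv] at e1
  have e2 := F.mul x⁻¹ (y⁻¹ * x * y)
  rw [F.yxy ho h2 x y hx hy, F.inv] at e2
  have e3 : T (x⁻¹ * D.z (y⁻¹ * x * y)) = T (x⁻¹ * y⁻¹ * (x⁻¹ * y)) := by
    rw [← F.ta]
    congr 1
    simp only [map_mul, map_inv, hza, hzb, hx, hab, mul_assoc, inv_inv]
  rw [e3] at e2
  have e4 : x⁻¹ * (y⁻¹ * x * y) = x⁻¹ * y⁻¹ * (x * y) := by group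
  rw [e4] at e2
  apply h2.mul_left_cancel
  linear_combination e1 - e2

variable (hp : p.Prime) (h0 : (p : R) = 0) (hG : IsPGroup p G)

omit ho [Finite G] in
include hG in
theorem unit (x : G) (hx : D.z x = x⁻¹) : IsUnit (T x + 1) := by
  obtain ⟨k, hk⟩ := hG x
  have : IsNilpotent (T x - 1) := ⟨_, F.nil k x hx hk⟩
  have h3 := this.isUnit_add_left_of_commute h2 (Commute.all _ _)
  have e : 2 + (T x - 1) = T x + 1 := by ring
  rwa [e] at h3

variable (k : ℕ) (hq : ∀ c, D.s c = c → c ^ p ^ k = 1)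
include hG hq

theorem key (x : G) (hx : D.a x = x) : (T x * T (D.s x) - 1) ^ p ^ k = 0 := by
  set y := D.s x with hyd
  have hy : D.b y = y := by rw [hyd, ← D.sa, hx]
  have hza := D.z_a ho x hx
  have hzb := D.z_b ho y hy
  obtain ⟨d, f, m, h, h1, h3, h4, h5, h6⟩ :=
    DL' ho D.z D.s D.zz D.ss (fun x => (D.sz x).symm) (x * y)
  have h' : y * x = d * f⁻¹ * D.s m := by
    have := congrArg D.s h
    simp only [map_mul, h3, h5] at this
    rw [← this, hyd, D.ss]
  have hsm : D.z (D.s m) = D.s m := by rw [← D.sz, h6]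
  have e1 := F.mul d f
  rw [h4] at e1
  have e2 : T (d * f) = T x * T y := by
    rw [← F.rm _ m h6, ← h, F.xy ho h2 x y hx hy]
  have e3 : T (d * f⁻¹) = T x * T y := by
    rw [← F.rm _ _ hsm, ← h', ← F.inv, mul_inv_rev,
      F.xy ho h2 x⁻¹ y⁻¹ (by rw [map_inv, hx]) (by rw [map_inv, hy]), F.inv, F.inv]
  have e4 : T d * T f = T x * T y := by
    apply h2.mul_left_cancel
    rw [e2, e3] at e1
    linear_combination e1
  have e5 : T (f * f) = T (x⁻¹ * y⁻¹ * (x * y)) := by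
    have : x⁻¹ * y⁻¹ * (x * y) = (D.s m)⁻¹ * (f * f * m) := by
      rw [← mul_inv_rev, h', h]; group
    rw [this, F.lm _ (D.s m)⁻¹ (by rw [map_inv, hsm]), F.rm _ _ h6]
  rw [F.x2 f h4, F.comm ho h2 x y hx hy] at e5
  have hd := F.nil k d h1 (hq d h3)
  have key : (T x + 1) * (T y + 1) * (T x * T y - 1) = (T d - 1) * ((T d + 1) * (2 * T f ^ 2)) := by
    linear_combination e5 - 2 * (T d * T f + T x * T y) * e4
  have hu := (F.unit h2 hG x hza).mul (F.unit h2 hG y hzb)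
  have := congrArg (· ^ p ^ k) key
  simp only [mul_pow, hd, zero_mul] at this
  rw [← mul_pow] at this
  exact (hu.pow _).mul_right_eq_zero.mp this

include hp h0

theorem keyA (x : G) (hx : D.a x = x) : (T x - 1) ^ p ^ (k + 1) = 0 := by
  have k1 := F.key ho h2 hG k hq x hx
  have k2 := F.key ho h2 hG k hq (x * x) (by rw [map_mul, hx])
  have hza := D.z_a ho x hx
  have hy : D.b (D.s x) = D.s x := by rw [← D.sa, hx]
  have hzb := D.z_b ho _ hy
  rw [map_mul, F.x2 x hza, F.x2 _ hzb] at k2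
  set A := T x
  set B := T (D.s x)
  have hfs : ∀ (j : ℕ) (u v : R), (u + v) ^ p ^ j = u ^ p ^ j + v ^ p ^ j :=
    fun j u v => frob hp h0 j (Commute.all _ _)
  have e1 : (2 * (A - B) ^ 2) ^ p ^ k = 0 := by
    have : 2 * (A - B) ^ 2 = 4 * A * B * (A * B - 1) + (-1) * ((2 * A ^ 2 - 1) * (2 * B ^ 2 - 1) - 1) := by
      ring
    rw [this, hfs, mul_pow _ (A * B - 1), k1, mul_pow (-1 : R), k2]; simp
  rw [mul_pow, (h2.pow _).mul_right_eq_zero, ← pow_mul] at e1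
  have e2 : (A - B) ^ p ^ (k + 1) = 0 := by
    apply pow_eq_zero_of_le _ e1
    rw [pow_succ, mul_comm]
    exact Nat.mul_le_mul_left _ hp.two_le
  have e3 : (A * B - 1) ^ p ^ (k + 1) = 0 :=
    pow_eq_zero_of_le (Nat.pow_le_pow_right hp.pos (Nat.le_succ k)) k1
  have e4 : ((A + 1) * (A - 1)) ^ p ^ (k + 1) = 0 := by
    have : (A + 1) * (A - 1) = (A * B - 1) + A * (A - B) := by ring
    rw [this, hfs, e3, mul_pow, e2]; simp
  rw [mul_pow, ((F.unit h2 hG x hza).pow _).mul_right_eq_zero] at e4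
  exact e4

theorem keyB (y : G) (hy : D.b y = y) : (T y - 1) ^ p ^ (k + 1) = 0 := by
  have hx : D.a (D.s y) = D.s y := by rw [← D.sb, hy]
  have k1 := F.key ho h2 hG k hq _ hx
  rw [D.ss] at k1
  have e3 : (T (D.s y) * T y - 1) ^ p ^ (k + 1) = 0 :=
    pow_eq_zero_of_le (Nat.pow_le_pow_right hp.pos (Nat.le_succ k)) k1
  have k2 := F.keyA ho h2 hp h0 hG k hq _ hx
  have : T y - 1 = (T (D.s y) * T y - 1) + (T (D.s y) - 1) * (- T y) := by ring
  rw [this, frob hp h0 _ (Commute.all _ _), e3, mul_pow, k2]; simp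

theorem keyAll (h : G) : (T h - 1) ^ p ^ (k + 1) = 0 := by
  obtain ⟨x, y, m, rfl, h1, h3, h4⟩ := D.xym ho h
  rw [F.rm _ _ h4, F.xy ho h2 x y h1 h3]
  have k1 := F.keyA ho h2 hp h0 hG k hq _ h1
  have k3 := F.keyB ho h2 hp h0 hG k hq _ h3
  have : T x * T y - 1 = (T x - 1) * T y + (T y - 1) := by ring
  rw [this, frob hp h0 _ (Commute.all _ _), mul_pow, k1, k3]; simp

end Fun
end D8P


namespace D8P

universe u

/-- one involution acting on a representation -/
structure Inv1 {G : Type*} [Group G] (σ : G →* G) {E : Type*} [Ring E] (ρ : G →* E) (π : E) :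
    Prop where
  ss : ∀ x, σ (σ x) = x
  idem : π * π = π
  int : ∀ g, (2 * π - 1) * ρ g = ρ (σ g) * (2 * π - 1)
  fixr : ∀ m, σ m = m → ρ m * π = π

/-- the compression of `ρ g` -/
def TT {G : Type*} [Group G] {E : Type*} [Ring E] (ρ : G →* E) (π : E) (g : G) : E :=
  π * ρ g * π + (1 - π)

namespace Inv1
variable {G : Type*} [Group G] {σ : G →* G} {E : Type*} [Ring E] {ρ : G →* E} {π : E}
  (I : Inv1 σ ρ π)
include I

theorem two_pi (h : G) : 2 * (π * ρ h) = ρ h + ρ (σ h) * (2 * π - 1) := by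
  rw [← I.int]; noncomm_ring

theorem idem' (x : E) : π * (π * x) = π * x := by rw [← mul_assoc, I.idem]

theorem Pmul (g h : G) : 2 * ((π * ρ g * π) * (π * ρ h * π)) =
    π * ρ (g * h) * π + π * ρ (g * σ h) * π := by
  have e : 2 * ((π * ρ g * π) * (π * ρ h * π)) = π * ρ g * (2 * (π * ρ h)) * π := by
    have : (π * ρ g * π) * (π * ρ h * π) = π * ρ g * (π * ρ h) * π := by
      simp only [mul_assoc, I.idem']
    rw [this]; noncomm_ring
  rw [e, I.two_pi, map_mul, map_mul]
  have : (2 * π - 1) * π = π := by rw [sub_mul, mul_assoc, I.idem]; noncomm_ring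
  calc π * ρ g * (ρ h + ρ (σ h) * (2 * π - 1)) * π
      = π * (ρ g * ρ h) * π + π * (ρ g * ρ (σ h)) * ((2 * π - 1) * π) := by noncomm_ring
    _ = _ := by rw [this]

theorem TT_mul (g h : G) : TT ρ π g * TT ρ π h = (π * ρ g * π) * (π * ρ h * π) + (1 - π) := by
  unfold TT
  simp only [mul_add, add_mul, mul_sub, sub_mul, mul_one, one_mul, mul_assoc, I.idem', I.idem]
  abel

theorem Tmul (g h : G) :
    2 * (TT ρ π g * TT ρ π h) = TT ρ π (g * h) + TT ρ π (g * σ h) := by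
  rw [I.TT_mul, mul_add, I.Pmul]
  unfold TT; noncomm_ring

omit I in
theorem Tone (I : Inv1 σ ρ π) : TT ρ π 1 = 1 := by
  unfold TT; rw [map_one, mul_one, I.idem]; noncomm_ring

variable (h2 : IsUnit (2 : E))
include h2

theorem fixl (m : G) (hm : σ m = m) : π * ρ m = π := by
  apply h2.mul_left_cancel
  rw [I.two_pi, hm, mul_sub, ← mul_assoc, (Commute.ofNat_right (ρ m) 2).eq, mul_assoc, I.fixr m hm]
  noncomm_ring

omit h2 in
theorem rm (g m : G) (hm : σ m = m) : TT ρ π (g * m) = TT ρ π g := by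
  unfold TT; rw [map_mul, mul_assoc π, mul_assoc (ρ g), I.fixr m hm, mul_assoc]

theorem lm (g m : G) (hm : σ m = m) : TT ρ π (m * g) = TT ρ π g := by
  unfold TT; rw [map_mul, ← mul_assoc π, I.fixl h2 m hm]

omit h2 in
theorem Tσ (g : G) : TT ρ π (σ g) = TT ρ π g := by
  unfold TT
  congr 1
  have h := congrArg (fun w => π * w * π) (I.int g)
  have e1 : π * ((2 * π - 1) * ρ g) * π = π * ρ g * π := by
    have : π * ((2 * π - 1) * ρ g) * π = 2 * ((π * π) * ρ g * π) - π * ρ g * π := by noncomm_ring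
    rw [this, I.idem]; noncomm_ring
  have e2 : π * (ρ (σ g) * (2 * π - 1)) * π = π * ρ (σ g) * π := by
    have : π * (ρ (σ g) * (2 * π - 1)) * π = 2 * (π * ρ (σ g) * (π * π)) - π * ρ (σ g) * π := by
      noncomm_ring
    rw [this, I.idem]; noncomm_ring
  rw [e1, e2] at h
  exact h.symm

variable [Finite G] (ho : Odd (Nat.card G))
include ho

theorem Tinv (g : G) : TT ρ π g⁻¹ = TT ρ π g := by
  obtain ⟨u, c, rfl, hu, hc, -⟩ := dec ho σ I.ss g
  rw [mul_inv_rev, I.lm h2 _ c⁻¹ (by rw [map_inv, hc]), I.rm _ c hc, ← hu, I.Tσ]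

theorem Tcomm (g h : G) : TT ρ π g * TT ρ π h = TT ρ π h * TT ρ π g := by
  obtain ⟨u, c, rfl, hu, hc, -⟩ := dec ho σ I.ss g
  obtain ⟨v, d, rfl, hv, hd, -⟩ := dec ho σ I.ss h
  rw [I.rm _ c hc, I.rm _ d hd]
  apply h2.mul_left_cancel
  rw [I.Tmul, I.Tmul, hu, hv]
  congr 1
  · rw [← I.Tσ, map_mul, hu, hv, ← mul_inv_rev, I.Tinv h2 ho]
  · rw [← I.Tinv h2 ho, mul_inv_rev, inv_inv]

omit [Finite G] ho in
theorem Tnil {p : ℕ} (hp : p.Prime) (h0 : (p : E) = 0) (k : ℕ) (c : G) (hc : σ c = c⁻¹)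
    (hk : c ^ p ^ k = 1) : (TT ρ π c - 1) ^ p ^ k = 0 := by
  set X := ρ c + ρ c⁻¹ - 2 with hX
  have e0 : ρ c⁻¹ * ρ c = 1 := by rw [← map_mul]; simp
  have e0' : ρ c * ρ c⁻¹ = 1 := by rw [← map_mul]; simp
  have e1 : 2 * (TT ρ π c - 1) = X * π := by
    have := congrArg (· * π) (I.two_pi c)
    simp only [hc] at this
    unfold TT
    have h3 : 2 * (π * ρ c * π + (1 - π) - 1) = 2 * (π * ρ c) * π - 2 * π := by noncomm_ring
    rw [h3, this]
    have : (ρ c + ρ c⁻¹ * (2 * π - 1)) * π = ρ c * π + ρ c⁻¹ * (2 * (π * π)) - ρ c⁻¹ * π := by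
      noncomm_ring
    rw [this, I.idem, hX]; noncomm_ring
  have e2 : Commute X π := by
    have h1 := I.int c
    have h3 := I.int c⁻¹
    rw [hc] at h1
    rw [map_inv σ, hc, inv_inv] at h3
    have : 2 * (X * π) = 2 * (π * X) := by
      have e : 2 * (π * X) = (2 * π - 1) * ρ c + (2 * π - 1) * ρ c⁻¹ + X - 4 * π + 2 := by
        rw [hX]; noncomm_ring
      rw [e, h1, h3, hX]; noncomm_ring
    exact h2.mul_left_cancel this
  have e3 : X = ρ c⁻¹ * ((ρ c + (-1)) * (ρ c + (-1))) := by
    have : ρ c⁻¹ * ((ρ c + (-1)) * (ρ c + (-1))) = (ρ c⁻¹ * ρ c) * ρ c - 2 * (ρ c⁻¹ * ρ c) + ρ c⁻¹ := by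
      noncomm_ring
    rw [this, e0, hX, one_mul, mul_one]; abel
  have e4 : (ρ c + (-1)) ^ p ^ k = 0 := by
    rw [frob hp h0 k (Commute.neg_one_right _), ← map_pow, hk, map_one]
    have := frob hp h0 k (x := (1 : E)) (y := -1) (Commute.neg_one_right _)
    rw [add_neg_cancel, zero_pow (pow_ne_zero _ hp.ne_zero), one_pow] at this
    exact this.symm
  have e5 : X ^ p ^ k = 0 := by
    have hcm : Commute (ρ c⁻¹) (ρ c + (-1)) := by
      unfold Commute SemiconjBy
      rw [mul_add, add_mul, e0, e0']; noncomm_ring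
    rw [e3, (hcm.mul_right hcm).mul_pow, (Commute.refl _).mul_pow, e4]; simp
  have e6 : (2 * (TT ρ π c - 1)) ^ p ^ k = 0 := by
    rw [e1, e2.mul_pow, e5, zero_mul]
  rw [(Commute.ofNat_left 2 (TT ρ π c - 1)).mul_pow] at e6
  exact (h2.pow _).mul_right_eq_zero.mp e6

end Inv1

/-- the three involutions of the four-group -/
def D8S.σ {G : Type*} [Group G] (D : D8S G) : Fin 3 → (G →* G) := ![D.a, D.b, D.z]

theorem D8S.σ0 {G : Type*} [Group G] (D : D8S G) : D.σ 0 = D.a := rfl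
theorem D8S.σ1 {G : Type*} [Group G] (D : D8S G) : D.σ 1 = D.b := rfl
theorem D8S.σ2 {G : Type*} [Group G] (D : D8S G) : D.σ 2 = D.z := rfl

/-- representation with action of the four-group -/
structure Rep {G : Type*} [Group G] (D : D8S G) (p : ℕ) {E : Type*} [Ring E] (ρ : G →* E)
    (π : Fin 3 → E) : Prop where
  h0 : (p : E) = 0
  orth : ∀ u v, u ≠ v → π u * π v = 0
  idem : ∀ v, π v * π v = π v
  sum : π 0 + π 1 + π 2 = 1
  int : ∀ v g, (2 * π v - 1) * ρ g = ρ (D.σ v g) * (2 * π v - 1)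
  fixr : ∀ v m, D.σ v m = m → ρ m * π v = π v

theorem exists_comm_ring {E : Type u} [Ring E] {s : Set E}
    (hc : ∀ x ∈ s, ∀ y ∈ s, x * y = y * x) :
    ∃ (R : Type u) (_ : CommRing R) (i : R →+* E), Function.Injective i ∧ ∀ x ∈ s, ∃ r, i r = x := by
  have h := Subring.isMulCommutative_closure hc
  exact ⟨Subring.closure s, { (Subring.closure s).toRing with mul_comm := h.1.comm },
    (Subring.closure s).subtype, Subtype.val_injective,
    fun x hx => ⟨⟨x, Subring.subset_closure hx⟩, rfl⟩⟩

namespace Rep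
variable {G : Type*} [Group G] {D : D8S G} {p : ℕ} {E : Type*} [Ring E] {ρ : G →* E}
  {π : Fin 3 → E} (I : Rep D p ρ π)
include I

theorem inv1 (v : Fin 3) : Inv1 (D.σ v) ρ (π v) where
  ss := by
    fin_cases v
    · exact D.aa
    · exact D.bb
    · exact D.zz
  idem := I.idem v
  int := I.int v
  fixr := I.fixr v

theorem sl {u v : Fin 3} (h : u ≠ v) : (2 * π u - 1) * π v = - π v := by
  rw [sub_mul, mul_assoc, I.orth u v h]; noncomm_ring

theorem sr {u v : Fin 3} (h : u ≠ v) : π v * (2 * π u - 1) = - π v := by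
  have : π v * (2 * π u - 1) = 2 * (π v * π u) - π v := by noncomm_ring
  rw [this, I.orth v u h.symm]; noncomm_ring

theorem Tu {u v : Fin 3} (h : u ≠ v) (g : G) : TT ρ (π v) (D.σ u g) = TT ρ (π v) g := by
  unfold TT
  congr 1
  have e := congrArg (fun w => π v * w * π v) (I.int u g)
  have e1 : π v * ((2 * π u - 1) * ρ g) * π v = - (π v * ρ g * π v) := by
    rw [← mul_assoc, I.sr h]; noncomm_ring
  have e2 : π v * (ρ (D.σ u g) * (2 * π u - 1)) * π v = - (π v * ρ (D.σ u g) * π v) := by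
    rw [mul_assoc, mul_assoc, I.sl h]; noncomm_ring
  rw [e1, e2] at e
  exact (neg_injective e).symm

theorem cross {u v : Fin 3} (h : u ≠ v) (g : G) :
    2 * (π u * ρ g * π v) = (ρ g - ρ (D.σ u g)) * π v := by
  have e := congrArg (fun w => w * π v) (I.int u g)
  simp only [mul_assoc (ρ (D.σ u g)), I.sl h] at e
  have : 2 * (π u * ρ g * π v) = (2 * π u - 1) * ρ g * π v + ρ g * π v := by noncomm_ring
  rw [this, e]; noncomm_ring

theorem star {u v : Fin 3} (h : u ≠ v) (g y w : G) (hy : D.σ u y = y) :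
    TT ρ (π v) (g * y * w) - TT ρ (π v) (g * y * D.σ u w) =
      TT ρ (π v) (g * w) - TT ρ (π v) (g * D.σ u w) := by
  unfold TT
  have e1 : ∀ t, π v * ρ (t * w) * π v + (1 - π v) - (π v * ρ (t * D.σ u w) * π v + (1 - π v)) =
      π v * ρ t * (2 * (π u * ρ w * π v)) := by
    intro t
    rw [I.cross h, map_mul, map_mul]; noncomm_ring
  rw [e1, e1, map_mul]
  have : π v * (ρ g * ρ y) * (2 * (π u * ρ w * π v)) = π v * ρ g * (2 * ((ρ y * π u) * ρ w * π v)) := by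
    noncomm_ring
  rw [this, I.fixr u y hy]

theorem loop2 {u v : Fin 3} (h : u ≠ v) (g w : G) :
    2 * (π v * ρ g * π u * ρ w * π v) = TT ρ (π v) (g * w) - TT ρ (π v) (g * D.σ u w) := by
  have : 2 * (π v * ρ g * π u * ρ w * π v) = π v * ρ g * (2 * (π u * ρ w * π v)) := by noncomm_ring
  rw [this, I.cross h]
  unfold TT
  rw [map_mul, map_mul]; noncomm_ring

variable [Finite G] (ho : Odd (Nat.card G)) (hp : p.Prime) (hp2 : Odd p)
include ho hp hp2

theorem nilz (hG : IsPGroup p G) (k : ℕ) (hq : ∀ c, D.s c = c → c ^ p ^ k = 1) (u : E)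
    (hu : u ∈ AddSubgroup.closure (Set.range fun h => TT ρ (π 2) h - 1)) :
    u ^ p ^ (k + 1) = 0 := by
  have h2 : IsUnit (2 : E) := two_unit hp2 I.h0
  have J := I.inv1 2
  have hc : ∀ x ∈ Set.range (TT ρ (π 2)), ∀ y ∈ Set.range (TT ρ (π 2)), x * y = y * x := by
    rintro _ ⟨g, rfl⟩ _ ⟨h, rfl⟩
    exact J.Tcomm h2 ho g h
  obtain ⟨R, instR, i, hi, hr⟩ := exists_comm_ring hc
  choose T hT using fun g => hr (TT ρ (π 2) g) ⟨g, rfl⟩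
  have hp0 : (p : R) = 0 := hi (by rw [map_natCast, map_zero, I.h0])
  have F : Fun D p T :=
    { one := hi (by simpa [hT] using J.Tone)
      mul := fun g h => hi (by simpa only [D.σ0, D.σ1, D.σ2, hT, map_mul, map_add, map_ofNat] using J.Tmul g h)
      inv := fun g => hi (by simpa only [D.σ0, D.σ1, D.σ2, hT] using J.Tinv h2 ho g)
      rm := fun g m hm => hi (by simpa only [D.σ0, D.σ1, D.σ2, hT] using J.rm g m hm)
      lm := fun g m hm => hi (by simpa only [D.σ0, D.σ1, D.σ2, hT] using J.lm h2 g m hm)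
      ta := fun g => hi (by simpa only [D.σ0, D.σ1, D.σ2, hT] using I.Tu (u := 0) (v := 2) (by decide) g)
      tb := fun g => hi (by simpa only [D.σ0, D.σ1, D.σ2, hT] using I.Tu (u := 1) (v := 2) (by decide) g)
      sta := fun g x h hx => hi (by
        simpa only [D.σ0, D.σ1, D.σ2, hT, map_sub i] using I.star (u := 0) (v := 2) (by decide) g x h hx)
      stb := fun g x h hx => hi (by
        simpa only [D.σ0, D.σ1, D.σ2, hT, map_sub i] using I.star (u := 1) (v := 2) (by decide) g x h hx)
      nil := fun k c hc hk => hi (by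
        simpa only [D.σ0, D.σ1, D.σ2, hT, map_pow, map_sub, map_one, map_zero] using J.Tnil h2 hp I.h0 k c hc hk) }
  have h2R : IsUnit (2 : R) := two_unit hp2 hp0
  have hall := F.keyAll ho h2R hp hp0 hG k hq
  have : ∃ r : R, r ^ p ^ (k + 1) = 0 ∧ i r = u := by
    induction hu using AddSubgroup.closure_induction with
    | mem x hx =>
      obtain ⟨h, rfl⟩ := hx
      exact ⟨T h - 1, hall h, by rw [map_sub, map_one, hT]⟩
    | zero => exact ⟨0, zero_pow (pow_ne_zero _ hp.ne_zero), map_zero i⟩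
    | add x y _ _ hx hy =>
      obtain ⟨r, hr, rfl⟩ := hx
      obtain ⟨t, ht, rfl⟩ := hy
      refine ⟨r + t, ?_, map_add i r t⟩
      rw [frob hp hp0 _ (Commute.all _ _), hr, ht, add_zero]
    | neg x _ hx =>
      obtain ⟨r, hr, rfl⟩ := hx
      refine ⟨-r, ?_, map_neg i r⟩
      rw [neg_pow, hr, mul_zero]
  obtain ⟨r, hr, rfl⟩ := this
  rw [← map_pow, hr, map_zero]

end Rep
end D8P


namespace D8P

theorem commute_closure {E : Type*} [Ring E] {s : Set E} (h : ∀ x ∈ s, ∀ y ∈ s, Commute x y) :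
    ∀ x ∈ AddSubgroup.closure s, ∀ y ∈ AddSubgroup.closure s, Commute x y := by
  have h1 : ∀ x ∈ AddSubgroup.closure s, ∀ y ∈ s, Commute x y := by
    intro x hx y hy
    induction hx using AddSubgroup.closure_induction with
    | mem x hx => exact h x hx y hy
    | zero => exact Commute.zero_left _
    | add a b _ _ ha hb => exact ha.add_left hb
    | neg a _ ha => exact ha.neg_left
  intro x hx y hy
  induction hy using AddSubgroup.closure_induction with
  | mem y hy => exact h1 x hx y hy
  | zero => exact Commute.zero_right _
  | add a b _ _ ha hb => exact ha.add_right hb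
  | neg a _ ha => exact ha.neg_right

theorem half_mem {E : Type*} [Ring E] {p : ℕ} (hp : Odd p) (h0 : (p : E) = 0)
    (H : AddSubgroup E) {w : E} (h : 2 * w ∈ H) : w ∈ H := by
  obtain ⟨k, rfl⟩ := hp
  have : w = -(k • (2 * w)) := by
    have e : ((2 * k + 1 : ℕ) : E) * w = 0 := by rw [h0, zero_mul]
    push_cast at e
    rw [nsmul_eq_mul, ← mul_assoc, (Nat.cast_commute k (2 : E)).eq]
    rw [add_mul, one_mul] at e
    exact eq_neg_of_add_eq_zero_right e
  rw [this]
  exact H.neg_mem (H.nsmul_mem h k)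

section pig
variable {E : Type*} [Ring E] (𝒜 : Subring E) (Λ : Finset E) (hΛ : ∀ l ∈ Λ, l ∈ 𝒜) (n : ℕ)
  (hn : ∀ l ∈ Λ, l ^ n = 0) (H : ∀ l ∈ Λ, ∀ B ∈ 𝒜, ∃ B' ∈ 𝒜, l * B * l = l * l * B')
include hΛ hn H

omit hΛ hn in
theorem pig_aux (l : E) (hl : l ∈ Λ) (k : ℕ) (B : E) (hB : B ∈ 𝒜) :
    ∃ B' ∈ 𝒜, l * B * l ^ k = l ^ (k + 1) * B' := by
  induction k with
  | zero => exact ⟨B, hB, by simp⟩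
  | succ k ih =>
    obtain ⟨B', hB', h⟩ := ih
    obtain ⟨B2, hB2, h2⟩ := H l hl B' hB'
    refine ⟨B2, hB2, ?_⟩
    rw [pow_succ l k, ← mul_assoc, h, pow_succ, mul_assoc, mul_assoc, ← mul_assoc l, h2, pow_succ,
      pow_succ]
    simp only [mul_assoc]

omit hn in
theorem pig_list (L : List (E × E × E)) (hL : ∀ t ∈ L, t.1 ∈ 𝒜 ∧ t.2.1 ∈ Λ ∧ t.2.2 ∈ 𝒜)
    [DecidableEq E] (l : E) (hl : l ∈ Λ) :
    ∃ A ∈ 𝒜, ∃ B ∈ 𝒜, (L.map fun t => t.1 * t.2.1 * t.2.2).prod =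
      A * l ^ ((L.map fun t => t.2.1).count l) * B := by
  induction L with
  | nil => exact ⟨1, 𝒜.one_mem, 1, 𝒜.one_mem, by simp⟩
  | cons t L ih =>
    obtain ⟨A, hA, B, hB, h⟩ := ih (fun t ht => hL t (List.mem_cons_of_mem _ ht))
    obtain ⟨h1, h2, h3⟩ := hL t List.mem_cons_self
    simp only [List.map_cons, List.prod_cons, List.count_cons, h]
    by_cases e : t.2.1 = l
    · obtain ⟨B', hB', h'⟩ := pig_aux 𝒜 Λ H l hl ((L.map fun t => t.2.1).count l) (t.2.2 * A)
        (𝒜.mul_mem h3 hA)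
      refine ⟨t.1, h1, B' * B, 𝒜.mul_mem hB' hB, ?_⟩
      rw [e]
      simp only [BEq.rfl, ite_true]
      rw [← mul_assoc _ B' B, mul_assoc t.1 _ B', ← h']
      simp only [mul_assoc]
    · refine ⟨t.1 * t.2.1 * t.2.2 * A, 𝒜.mul_mem (𝒜.mul_mem (𝒜.mul_mem h1 (hΛ _ h2)) h3) hA, B, hB, ?_⟩
      simp [e, mul_assoc]

theorem pig (K : ℕ) (hK : Λ.card * n < K) :
    (Submodule.span ℤ {t : E | ∃ C ∈ 𝒜, ∃ l ∈ Λ, ∃ C' ∈ 𝒜, t = C * l * C'}) ^ K = ⊥ := by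
  classical
  rw [Submodule.span_pow, Submodule.span_eq_bot]
  intro x hx
  rw [Set.mem_pow] at hx
  obtain ⟨f, rfl⟩ := hx
  choose C hC l hl C' hC' h using fun i => (f i).2
  have e : (List.ofFn fun i => ((f i : E))) =
      (List.ofFn fun i => (C i, l i, C' i)).map fun t => t.1 * t.2.1 * t.2.2 := by
    rw [List.map_ofFn]
    congr 1
    funext i
    exact h i
  rw [e]
  set L := List.ofFn fun i => (C i, l i, C' i) with hLd
  have hL : ∀ t ∈ L, t.1 ∈ 𝒜 ∧ t.2.1 ∈ Λ ∧ t.2.2 ∈ 𝒜 := by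
    intro t ht
    rw [hLd, List.mem_ofFn] at ht
    obtain ⟨i, rfl⟩ := ht
    exact ⟨hC i, hl i, hC' i⟩
  obtain ⟨x, hx, hx2⟩ : ∃ x ∈ Λ, n ≤ (L.map fun t => t.2.1).count x := by
    by_contra hcon
    push Not at hcon
    have h1 : ∑ x ∈ Λ, (L.map fun t => t.2.1).count x = K := by
      have := Multiset.sum_count_eq_card (s := Λ) (m := ((L.map fun t => t.2.1 : List E) : Multiset E))
        (by
          intro a ha
          simp only [Multiset.mem_coe, List.mem_map] at ha
          obtain ⟨t, ht, rfl⟩ := ha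
          exact (hL t ht).2.1)
      simpa [hLd] using this
    have h2 : ∑ x ∈ Λ, (L.map fun t => t.2.1).count x ≤ ∑ x ∈ Λ, n :=
      Finset.sum_le_sum fun x hx => (hcon x hx).le
    rw [h1, Finset.sum_const, smul_eq_mul] at h2
    omega
  obtain ⟨A, hA, B, hB, h⟩ := pig_list 𝒜 Λ hΛ H L hL x hx
  rw [h, pow_eq_zero_of_le hx2 (hn x hx)]
  simp

end pig

namespace Rep
variable {G : Type*} [Group G] {D : D8S G} {p : ℕ} {E : Type*} [Ring E] {ρ : G →* E}
  {π : Fin 3 → E} (I : Rep D p ρ π)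

/-- subring generated by everything -/
def alg (ρ : G →* E) (π : Fin 3 → E) : Subring E := Subring.closure (Set.range ρ ∪ Set.range π)

theorem rho_mem (g : G) : ρ g ∈ alg ρ π := Subring.subset_closure (Or.inl ⟨g, rfl⟩)
theorem pi_mem (v : Fin 3) : π v ∈ alg ρ π := Subring.subset_closure (Or.inr ⟨v, rfl⟩)

include I
variable (hp2 : Odd p)
include hp2

theorem Mstab (v : Fin 3) (w : E) (hw : w ∈ alg ρ π) :
    ∀ x ∈ AddSubgroup.closure (Set.range fun h => ρ h * π v),
      w * x ∈ AddSubgroup.closure (Set.range fun h => ρ h * π v) := by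
  have gen : ∀ w : E, (∀ h, w * (ρ h * π v) ∈ AddSubgroup.closure (Set.range fun h => ρ h * π v)) →
      ∀ x ∈ AddSubgroup.closure (Set.range fun h => ρ h * π v),
      w * x ∈ AddSubgroup.closure (Set.range fun h => ρ h * π v) := by
    intro w hw x hx
    induction hx using AddSubgroup.closure_induction with
    | mem x hx => obtain ⟨h, rfl⟩ := hx; exact hw h
    | zero => rw [mul_zero]; exact zero_mem _
    | add a b _ _ ha hb => rw [mul_add]; exact add_mem ha hb
    | neg a _ ha => rw [mul_neg]; exact neg_mem ha
  unfold alg at hw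
  induction hw using Subring.closure_induction with
  | mem w hw =>
    rcases hw with ⟨g, rfl⟩ | ⟨u, rfl⟩
    · apply gen
      intro h
      exact AddSubgroup.subset_closure ⟨g * h, by simp [mul_assoc]⟩
    · apply gen
      intro h
      apply half_mem hp2 I.h0
      by_cases e : u = v
      · subst e
        have h1 := (I.inv1 u).two_pi h
        have h2 : 2 * (π u * (ρ h * π u)) = (2 * (π u * ρ h)) * π u := by noncomm_ring
        have h3 : (ρ h + ρ (D.σ u h) * (2 * π u - 1)) * π u =
          ρ h * π u + (ρ (D.σ u h) * (2 * (π u * π u)) - ρ (D.σ u h) * π u) := by noncomm_ring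
        rw [h2, h1, h3, I.idem]
        have h4 : ρ h * π u + (ρ (D.σ u h) * (2 * π u) - ρ (D.σ u h) * π u) =
          ρ h * π u + ρ (D.σ u h) * π u := by noncomm_ring
        rw [h4]
        exact add_mem (AddSubgroup.subset_closure ⟨h, rfl⟩) (AddSubgroup.subset_closure ⟨_, rfl⟩)
      · rw [← mul_assoc (π u), I.cross e, sub_mul]
        exact sub_mem (AddSubgroup.subset_closure ⟨h, rfl⟩) (AddSubgroup.subset_closure ⟨_, rfl⟩)
  | zero => intro x _; rw [zero_mul]; exact zero_mem _
  | one => intro x hx; rwa [one_mul]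
  | add a b _ _ ha hb => intro x hx; rw [add_mul]; exact add_mem (ha x hx) (hb x hx)
  | neg a _ ha => intro x hx; rw [neg_mul]; exact neg_mem (ha x hx)
  | mul a b _ _ ha hb => intro x hx; rw [mul_assoc]; exact ha _ (hb x hx)

theorem Nmem (v : Fin 3) (w : E) (hw : w ∈ alg ρ π) :
    π v * w * π v ∈ AddSubgroup.closure (Set.range fun h => π v * ρ h * π v) := by
  have h1 := I.Mstab hp2 v w hw (π v) (AddSubgroup.subset_closure ⟨1, by simp⟩)
  rw [mul_assoc]
  generalize w * π v = x at h1
  induction h1 using AddSubgroup.closure_induction with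
  | mem x hx => obtain ⟨h, rfl⟩ := hx; exact AddSubgroup.subset_closure ⟨h, by simp [mul_assoc]⟩
  | zero => rw [mul_zero]; exact zero_mem _
  | add a b _ _ ha hb => rw [mul_add]; exact add_mem ha hb
  | neg a _ ha => rw [mul_neg]; exact neg_mem ha

variable [Finite G] (ho : Odd (Nat.card G))
include ho

theorem Ncomm (v : Fin 3) (w w' : E) (hw : w ∈ alg ρ π) (hw' : w' ∈ alg ρ π) :
    Commute (π v * w * π v) (π v * w' * π v) := by
  refine commute_closure ?_ _ (I.Nmem hp2 v w hw) _ (I.Nmem hp2 v w' hw')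
  rintro _ ⟨g, rfl⟩ _ ⟨h, rfl⟩
  have := (I.inv1 v).Tcomm (two_unit hp2 I.h0) ho g h
  rw [(I.inv1 v).TT_mul, (I.inv1 v).TT_mul] at this
  exact add_right_cancel this

/-- the commutation needed by the pigeonhole argument -/
theorem Hloop (v : Fin 3) (w B : E) (hw : w ∈ alg ρ π) (hB : B ∈ alg ρ π) :
    (π v * w * π v) * B * (π v * w * π v) =
      (π v * w * π v) * (π v * w * π v) * (π v * B * π v) := by
  have h := I.Ncomm hp2 ho v w B hw hB
  have h1 : (π v * w * π v) * B * (π v * w * π v) =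
      (π v * w * π v) * ((π v * B * π v) * (π v * w * π v)) := by
    simp only [mul_assoc, (I.inv1 v).idem']
  rw [h1, ← h.eq]; simp only [mul_assoc]

variable (hp : p.Prime) (hG : IsPGroup p G) (k : ℕ) (hq : ∀ c, D.s c = c → c ^ p ^ k = 1)
include hp hG hq

theorem nil_z1 (g : G) : (π 2 * (ρ g - 1) * π 2) ^ p ^ (k + 1) = 0 := by
  apply I.nilz ho hp hp2 hG k hq
  refine AddSubgroup.subset_closure ⟨g, ?_⟩
  simp only [TT]
  rw [mul_sub, mul_one, sub_mul, I.idem]; abel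

theorem nil_z2 (u : Fin 3) (hu : u ≠ 2) (g h : G) :
    (π 2 * ρ g * π u * ρ h * π 2) ^ p ^ (k + 1) = 0 := by
  apply I.nilz ho hp hp2 hG k hq
  apply half_mem hp2 I.h0
  rw [I.loop2 hu]
  have : TT ρ (π 2) (g * h) - TT ρ (π 2) (g * D.σ u h) =
    (TT ρ (π 2) (g * h) - 1) - (TT ρ (π 2) (g * D.σ u h) - 1) := by abel
  rw [this]
  exact sub_mem (AddSubgroup.subset_closure ⟨_, rfl⟩) (AddSubgroup.subset_closure ⟨_, rfl⟩)

theorem nil_v2 (v : Fin 3) (hv : v ≠ 2) (g h : G) :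
    (π v * ρ g * π 2 * ρ h * π v) ^ (p ^ (k + 1) + 1) = 0 := by
  have h1 := I.nil_z2 hp2 ho hp hG k hq v hv h g
  have gen : ∀ n, (π v * ρ g * π 2 * ρ h * π v) ^ (n + 1) =
      π v * ρ g * (π 2 * ρ h * π v * ρ g * π 2) ^ n * (π 2 * ρ h * π v) := by
    intro n
    induction n with
    | zero => simp only [zero_add, pow_one, pow_zero, mul_one, mul_assoc]
    | succ n ih =>
      rw [pow_succ, ih, pow_succ]
      simp only [mul_assoc, (I.inv1 2).idem', (I.inv1 v).idem']
  rw [gen, h1]; simp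

omit hp2 hp hG hq [Finite G] ho in
theorem pi_sub {u v : Fin 3} (h : u ≠ v) (g : G) : π u * (ρ g - 1) * π v = π u * ρ g * π v := by
  rw [mul_sub, mul_one, sub_mul, I.orth u v h, sub_zero]

/-- nilpotency of `π v (ρ y - 1) π v`, for `v ≠ z` and `y` fixed by the other one -/
theorem nil_v1 (v : Fin 3) (hv : v ≠ 2) (y : G) (h1 : D.σ v y = y⁻¹) (h3 : D.z y = y⁻¹) :
    (π v * (ρ y - 1) * π v) ^ (p ^ (k + 1) + 1) = 0 := by
  have h2 : IsUnit (2 : E) := two_unit hp2 I.h0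
  have e0 : π v * (ρ y - 1) * π v = TT ρ (π v) y - 1 := by
    simp only [TT]
    rw [mul_sub, mul_one, sub_mul, I.idem]; abel
  have e1 := I.nil_v2 hp2 ho hp hG k hq v hv y y
  have e2 := I.loop2 hv.symm y y
  have e3 := (I.inv1 v).Tmul y y
  rw [D.σ2, h3, mul_inv_cancel, (I.inv1 v).Tone] at e2
  rw [h1, mul_inv_cancel, (I.inv1 v).Tone] at e3
  have e4 : (TT ρ (π v) y + 1) * (TT ρ (π v) y - 1) = π v * ρ y * π 2 * ρ y * π v := by
    apply h2.mul_left_cancel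
    rw [e2]
    have : 2 * ((TT ρ (π v) y + 1) * (TT ρ (π v) y - 1)) = 2 * (TT ρ (π v) y * TT ρ (π v) y) - 1 - 1 := by
      noncomm_ring
    rw [this, e3]; abel
  rw [← e4] at e1
  have hc : Commute (TT ρ (π v) y + 1) (TT ρ (π v) y - 1) := by
    unfold Commute SemiconjBy; noncomm_ring
  have hu : IsUnit (TT ρ (π v) y + 1) := by
    obtain ⟨j, hj⟩ := hG y
    have : IsNilpotent (TT ρ (π v) y - 1) := ⟨_, (I.inv1 v).Tnil h2 hp I.h0 j y h1 hj⟩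
    have h3 := this.isUnit_add_left_of_commute h2 (Commute.ofNat_right _ 2)
    have e : 2 + (TT ρ (π v) y - 1) = TT ρ (π v) y + 1 := by
      rw [← one_add_one_eq_two]; abel
    rwa [e] at h3
  rw [hc.mul_pow] at e1
  rw [e0]
  exact (hu.pow _).mul_right_eq_zero.mp e1

omit hp2 hp hG hq [Finite G] ho in
theorem fixr' (v : Fin 3) (m : G) (hm : D.σ v m = m) : (ρ m - 1) * π v = 0 := by
  rw [sub_mul, one_mul, I.fixr v m hm, sub_self]

omit hp hG hq [Finite G] ho in
theorem fixl' (v : Fin 3) (m : G) (hm : D.σ v m = m) : π v * (ρ m - 1) = 0 := by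
  rw [mul_sub, mul_one, (I.inv1 v).fixl (two_unit hp2 I.h0) m hm, sub_self]

omit hp hG hq [Finite G] ho in
theorem step_zero (g : G) (hg : D.a g = g ∨ D.b g = g) (u v : Fin 3)
    (h : (u = 0 ∧ v = 1) ∨ (u = 1 ∧ v = 0)) : π u * (ρ g - 1) * π v = 0 := by
  rcases h with ⟨rfl, rfl⟩ | ⟨rfl, rfl⟩ <;> rcases hg with hg | hg
  · rw [I.fixl' hp2 0 g hg, zero_mul]
  · rw [mul_assoc, I.fixr' 1 g hg, mul_zero]
  · rw [mul_assoc, I.fixr' 0 g hg, mul_zero]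
  · rw [I.fixl' hp2 1 g hg, zero_mul]

theorem loop1_nil (v : Fin 3) (g : G) (hg : D.a g = g ∨ D.b g = g) :
    (π v * (ρ g - 1) * π v) ^ (p ^ (k + 1) + 1) = 0 := by
  fin_cases v
  · rcases hg with hg | hg
    · change (π 0 * (ρ g - 1) * π 0) ^ (p ^ (k + 1) + 1) = 0
      rw [I.fixl' hp2 0 g hg]; simp
    · exact I.nil_v1 hp2 ho hp hG k hq 0 (by decide) g (D.a_b ho g hg) (D.z_b ho g hg)
  · rcases hg with hg | hg
    · exact I.nil_v1 hp2 ho hp hG k hq 1 (by decide) g (D.b_a ho g hg) (D.z_a ho g hg)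
    · change (π 1 * (ρ g - 1) * π 1) ^ (p ^ (k + 1) + 1) = 0
      rw [I.fixl' hp2 1 g hg]; simp
  · change (π 2 * (ρ g - 1) * π 2) ^ (p ^ (k + 1) + 1) = 0
    rw [pow_succ, I.nil_z1 hp2 ho hp hG k hq, zero_mul]

theorem loop2_nil (v u : Fin 3) (huv : u ≠ v) (g h : G) (hg : D.a g = g ∨ D.b g = g) :
    (π v * ((ρ g - 1) * π u * (ρ h - 1)) * π v) ^ (p ^ (k + 1) + 1) = 0 := by
  have e : π v * ((ρ g - 1) * π u * (ρ h - 1)) * π v = π v * ρ g * π u * ρ h * π v := by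
    have e1 := I.pi_sub huv.symm g
    have e2 := I.pi_sub huv h
    calc π v * ((ρ g - 1) * π u * (ρ h - 1)) * π v
        = (π v * (ρ g - 1) * π u) * (π u * (ρ h - 1) * π v) := by
          simp only [mul_assoc, (I.inv1 u).idem']
      _ = _ := by rw [e1, e2]; simp only [mul_assoc, (I.inv1 u).idem']
  by_cases hv : v = 2
  · subst hv
    rw [e, pow_succ, I.nil_z2 hp2 ho hp hG k hq u huv, zero_mul]
  · by_cases hu : u = 2
    · subst hu
      rw [e, I.nil_v2 hp2 ho hp hG k hq v hv]
    · have : (v = 0 ∧ u = 1) ∨ (v = 1 ∧ u = 0) := by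
        clear e
        revert u v; decide
      have h0 := I.step_zero hp2 g hg v u this
      have : π v * ((ρ g - 1) * π u * (ρ h - 1)) * π v = (π v * (ρ g - 1) * π u) * (ρ h - 1) * π v := by
        noncomm_ring
      rw [this, h0]; simp

end Rep
end D8P


namespace D8P

/-- nilpotency length -/
def Lf (p k d : ℕ) : ℕ := 3 * ((3 * d + 9 * (d * d)) * (p ^ (k + 1) + 1) + 1)

theorem mul_le_mul_right_sub {E : Type*} [Ring E] {M N P : Submodule ℤ E} (h : N ≤ P) :
    M * N ≤ M * P := mul_le_mul' le_rfl h
theorem mul_le_mul_left_sub {E : Type*} [Ring E] {M N P : Submodule ℤ E} (h : N ≤ P) :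
    N * M ≤ P * M := mul_le_mul' h le_rfl

theorem fin3_aux : ∀ u0 u1 u2 u3 : Fin 3, ¬u1 = u0 → ¬u2 = u1 → ¬u3 = u2 → ¬u2 = u0 → ¬u3 = u1 →
    ((u0 = 0 ∧ u1 = 1) ∨ (u0 = 1 ∧ u1 = 0)) ∨ ((u1 = 0 ∧ u2 = 1) ∨ (u1 = 1 ∧ u2 = 0)) ∨
      ((u2 = 0 ∧ u3 = 1) ∨ (u2 = 1 ∧ u3 = 0)) := by
  intro u0 u1 u2 u3 h1 h2 h3 h4 h5
  omega

namespace Rep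
variable {G : Type*} [Group G] {D : D8S G} {p : ℕ} {E : Type*} [Ring E] {ρ : G →* E}
  {π : Fin 3 → E} (I : Rep D p ρ π) [Finite G] (ho : Odd (Nat.card G)) (hp2 : Odd p)
  (hp : p.Prime) (hG : IsPGroup p G) (k : ℕ) (hq : ∀ c, D.s c = c → c ^ p ^ k = 1)
  (S : Finset G) (hS : ∀ g ∈ S, D.a g = g ∨ D.b g = g) (d : ℕ) (hd : S.card ≤ d)
include I ho hp2 hp hG hq hS hd

theorem span_nil :
    (Submodule.span ℤ {x : E | ∃ g ∈ S, x = ρ g - 1}) ^ Lf p k d = ⊥ := by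
  classical
  have rm1 : ∀ g, ρ g - 1 ∈ alg ρ π := fun g => sub_mem (rho_mem g) (one_mem _)
  have pim : ∀ v, π v ∈ alg ρ π := pi_mem
  let Λ1 : Finset E := (Finset.univ ×ˢ S).image fun t : Fin 3 × G => π t.1 * (ρ t.2 - 1) * π t.1
  let Λ2 : Finset E := (((Finset.univ ×ˢ Finset.univ).filter
    fun t : Fin 3 × Fin 3 => t.2 ≠ t.1) ×ˢ (S ×ˢ S)).image
      fun t : (Fin 3 × Fin 3) × (G × G) =>
        π t.1.1 * ((ρ t.2.1 - 1) * π t.1.2 * (ρ t.2.2 - 1)) * π t.1.1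
  let Λ : Finset E := Λ1 ∪ Λ2
  have m1 : ∀ v, ∀ g ∈ S, π v * (ρ g - 1) * π v ∈ Λ := by
    intro v g hg
    refine Finset.mem_union_left _ (Finset.mem_image.mpr ⟨(v, g), ?_, rfl⟩)
    simp [hg]
  have m2 : ∀ v u, u ≠ v → ∀ g ∈ S, ∀ h ∈ S, π v * ((ρ g - 1) * π u * (ρ h - 1)) * π v ∈ Λ := by
    intro v u huv g hg h hh
    refine Finset.mem_union_right _ (Finset.mem_image.mpr ⟨((v, u), (g, h)), ?_, rfl⟩)
    simp [hg, hh, huv]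
  have hcard : Λ.card ≤ 3 * d + 9 * (d * d) := by
    refine (Finset.card_union_le _ _).trans (add_le_add ?_ ?_)
    · refine Finset.card_image_le.trans ?_
      rw [Finset.card_product]
      simpa using hd
    · refine Finset.card_image_le.trans ?_
      rw [Finset.card_product, Finset.card_product]
      refine Nat.mul_le_mul ?_ (Nat.mul_le_mul hd hd)
      exact (Finset.card_filter_le _ _).trans (by simp)
  have hform : ∀ l ∈ Λ, (∃ v, ∃ w ∈ alg ρ π, l = π v * w * π v) ∧ l ^ (p ^ (k + 1) + 1) = 0 := by
    intro l hl
    rcases Finset.mem_union.mp hl with hl | hl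
    · obtain ⟨⟨v, g⟩, hg, rfl⟩ := Finset.mem_image.mp hl
      simp only [Finset.mem_product, Finset.mem_univ, true_and] at hg
      exact ⟨⟨v, _, rm1 g, rfl⟩, I.loop1_nil hp2 ho hp hG k hq v g (hS g hg)⟩
    · obtain ⟨⟨⟨v, u⟩, ⟨g, h⟩⟩, hg, rfl⟩ := Finset.mem_image.mp hl
      simp only [Finset.mem_product, Finset.mem_filter, Finset.mem_univ, true_and] at hg
      exact ⟨⟨v, _, mul_mem (mul_mem (rm1 g) (pim u)) (rm1 h), rfl⟩,
        I.loop2_nil hp2 ho hp hG k hq v u hg.1 g h (hS g hg.2.1)⟩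
  have P := pig (alg ρ π) Λ
    (by
      intro l hl
      obtain ⟨⟨v, w, hw, rfl⟩, -⟩ := hform l hl
      exact mul_mem (mul_mem (pim v) hw) (pim v))
    (p ^ (k + 1) + 1) (fun l hl => (hform l hl).2)
    (by
      intro l hl B hB
      obtain ⟨⟨v, w, hw, rfl⟩, -⟩ := hform l hl
      exact ⟨_, mul_mem (mul_mem (pim v) hB) (pim v), I.Hloop hp2 ho v w B hw hB⟩)
    ((3 * d + 9 * (d * d)) * (p ^ (k + 1) + 1) + 1)
    (Nat.lt_succ_of_le (Nat.mul_le_mul_right _ hcard))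
  unfold Lf
  rw [pow_mul, eq_bot_iff, ← P]
  refine pow_le_pow_left' ?_ _
  rw [Submodule.span_pow, Submodule.span_le]
  intro x hx
  obtain ⟨f, rfl⟩ := Set.mem_pow.mp hx
  obtain ⟨g1, hg1, e1⟩ := (f 0).2
  obtain ⟨g2, hg2, e2⟩ := (f 1).2
  obtain ⟨g3, hg3, e3⟩ := (f 2).2
  simp only [List.ofFn_succ, List.ofFn_zero, List.prod_cons, List.prod_nil, mul_one]
  have hh : ((f 0 : E) * ((f (Fin.succ 0) : E) * (f (Fin.succ (Fin.succ 0)) : E))) =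
      (ρ g1 - 1) * (ρ g2 - 1) * (ρ g3 - 1) := by
    rw [mul_assoc]
    exact congrArg₂ _ e1 (congrArg₂ _ e2 e3)
  rw [SetLike.mem_coe, hh]
  have h1 : (∑ v, π v) = 1 := by rw [Fin.sum_univ_three, I.sum]
  have hexp : (ρ g1 - 1) * (ρ g2 - 1) * (ρ g3 - 1) =
      ∑ u0, ∑ u1, ∑ u2, ∑ u3, π u0 * (ρ g1 - 1) * π u1 * (ρ g2 - 1) * π u2 * (ρ g3 - 1) * π u3 := by
    simp only [← Finset.mul_sum, ← Finset.sum_mul, h1, mul_one, one_mul]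
  rw [hexp]
  refine sum_mem fun u0 _ => sum_mem fun u1 _ => sum_mem fun u2 _ => sum_mem fun u3 _ => ?_
  have mem : ∀ C ∈ alg ρ π, ∀ l ∈ Λ, ∀ C' ∈ alg ρ π, C * l * C' ∈ Submodule.span ℤ
      {t : E | ∃ C ∈ alg ρ π, ∃ l ∈ Λ, ∃ C' ∈ alg ρ π, t = C * l * C'} := fun C hC l hl C' hC' =>
    Submodule.subset_span ⟨C, hC, l, hl, C', hC', rfl⟩
  have one : (1 : E) ∈ alg ρ π := one_mem _
  have X1 := rm1 g1
  have X2 := rm1 g2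
  have X3 := rm1 g3
  by_cases c1 : u1 = u0
  · subst c1
    convert mem 1 one _ (m1 u1 g1 hg1) ((ρ g2 - 1) * π u2 * (ρ g3 - 1) * π u3)
      (mul_mem (mul_mem (mul_mem X2 (pim _)) X3) (pim _)) using 1
    simp only [mul_assoc, one_mul]
  by_cases c2 : u2 = u1
  · subst c2
    convert mem (π u0 * (ρ g1 - 1)) (mul_mem (pim _) X1) _ (m1 u2 g2 hg2) ((ρ g3 - 1) * π u3)
      (mul_mem X3 (pim _)) using 1
    simp only [mul_assoc]
  by_cases c3 : u3 = u2
  · subst c3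
    convert mem (π u0 * (ρ g1 - 1) * π u1 * (ρ g2 - 1))
      (mul_mem (mul_mem (mul_mem (pim _) X1) (pim _)) X2) _ (m1 u3 g3 hg3) 1 one using 1
    simp only [mul_assoc, mul_one]
  by_cases c4 : u2 = u0
  · subst c4
    convert mem 1 one _ (m2 u2 u1 c1 g1 hg1 g2 hg2) ((ρ g3 - 1) * π u3) (mul_mem X3 (pim _)) using 1
    simp only [mul_assoc, one_mul]
  by_cases c5 : u3 = u1
  · subst c5
    convert mem (π u0 * (ρ g1 - 1)) (mul_mem (pim _) X1) _ (m2 u3 u2 c2 g2 hg2 g3 hg3) 1 one using 1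
    simp only [mul_assoc, mul_one]
  have hz : ((u0 = 0 ∧ u1 = 1) ∨ (u0 = 1 ∧ u1 = 0)) ∨ ((u1 = 0 ∧ u2 = 1) ∨ (u1 = 1 ∧ u2 = 0)) ∨
      ((u2 = 0 ∧ u3 = 1) ∨ (u2 = 1 ∧ u3 = 0)) := by
    exact fin3_aux u0 u1 u2 u3 c1 c2 c3 c4 c5
  have hzero : π u0 * (ρ g1 - 1) * π u1 * (ρ g2 - 1) * π u2 * (ρ g3 - 1) * π u3 = 0 := by
    rcases hz with hz | hz | hz
    · rw [I.step_zero hp2 g1 (hS g1 hg1) _ _ hz]; simp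
    · have := I.step_zero hp2 g2 (hS g2 hg2) _ _ hz
      calc _ = π u0 * (ρ g1 - 1) * (π u1 * (ρ g2 - 1) * π u2) * (ρ g3 - 1) * π u3 := by
            simp only [mul_assoc]
        _ = 0 := by rw [this]; simp
    · have := I.step_zero hp2 g3 (hS g3 hg3) _ _ hz
      calc _ = π u0 * (ρ g1 - 1) * π u1 * (ρ g2 - 1) * (π u2 * (ρ g3 - 1) * π u3) := by
            simp only [mul_assoc]
        _ = 0 := by rw [this]; simp
  rw [hzero]
  exact zero_mem _

theorem list_nil (hcl : Subgroup.closure (S : Set G) = ⊤) (l : List G)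
    (hl : l.length = Lf p k d) : (l.map fun h => ρ h - 1).prod = 0 := by
  have hN := I.span_nil ho hp2 hp hG k hq S hS d hd
  set 𝒟 := Submodule.span ℤ {x : E | ∃ g ∈ S, x = ρ g - 1} with h𝒟
  set 𝒢 := Submodule.span ℤ (Set.range ρ) with h𝒢
  have hGG : 𝒢 * 𝒢 ≤ 𝒢 := by
    rw [h𝒢, Submodule.span_mul_span, Submodule.span_le]
    rintro _ ⟨_, ⟨g, rfl⟩, _, ⟨h, rfl⟩, rfl⟩
    exact Submodule.subset_span ⟨g * h, by simp⟩
  have hDGG : 𝒟 * 𝒢 * 𝒢 ≤ 𝒟 * 𝒢 := by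
    rw [mul_assoc]; exact mul_le_mul_right_sub hGG
  have hr : ∀ g, ρ g ∈ 𝒢 := fun g => Submodule.subset_span ⟨g, rfl⟩
  have hmem : ∀ h, ρ h - 1 ∈ 𝒟 * 𝒢 := by
    intro h
    have hh : h ∈ Subgroup.closure (S : Set G) := by rw [hcl]; trivial
    induction hh using Subgroup.closure_induction with
    | mem x hx =>
      have := Submodule.mul_mem_mul (M := 𝒟) (Submodule.subset_span ⟨x, hx, rfl⟩) (hr 1)
      simpa using this
    | one => simp
    | mul x y _ _ hx hy =>
      have : ρ (x * y) - 1 = (ρ x - 1) * ρ y + (ρ y - 1) := by rw [map_mul]; noncomm_ring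
      rw [this]
      exact add_mem (hDGG (Submodule.mul_mem_mul hx (hr y))) hy
    | inv x _ hx =>
      have : ρ x⁻¹ - 1 = -((ρ x - 1) * ρ x⁻¹) := by
        rw [sub_mul, ← map_mul, mul_inv_cancel, map_one]; noncomm_ring
      rw [this]
      exact neg_mem (hDGG (Submodule.mul_mem_mul hx (hr _)))
  have hGD : 𝒢 * 𝒟 ≤ 𝒟 * 𝒢 := by
    conv_lhs => rw [h𝒢, h𝒟, Submodule.span_mul_span]
    rw [Submodule.span_le]
    rintro _ ⟨_, ⟨g, rfl⟩, _, ⟨h, hh, rfl⟩, rfl⟩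
    have : ρ g * (ρ h - 1) = (ρ (g * h * g⁻¹) - 1) * ρ g := by
      rw [sub_mul, ← map_mul]; simp [mul_sub]
    change ρ g * (ρ h - 1) ∈ _
    rw [this]
    exact hDGG (Submodule.mul_mem_mul (hmem _) (hr g))
  have hpow : ∀ n, (𝒟 * 𝒢) ^ (n + 1) ≤ 𝒟 ^ (n + 1) * 𝒢 := by
    intro n
    induction n with
    | zero => simp
    | succ n ih =>
      calc (𝒟 * 𝒢) ^ (n + 1 + 1) = (𝒟 * 𝒢) ^ (n + 1) * (𝒟 * 𝒢) := pow_succ _ _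
        _ ≤ 𝒟 ^ (n + 1) * 𝒢 * (𝒟 * 𝒢) := mul_le_mul_left_sub ih
        _ = 𝒟 ^ (n + 1) * ((𝒢 * 𝒟) * 𝒢) := by simp only [mul_assoc]
        _ ≤ 𝒟 ^ (n + 1) * ((𝒟 * 𝒢) * 𝒢) :=
          mul_le_mul_right_sub (mul_le_mul_left_sub hGD)
        _ ≤ 𝒟 ^ (n + 1) * (𝒟 * 𝒢) := mul_le_mul_right_sub hDGG
        _ = 𝒟 ^ (n + 1 + 1) * 𝒢 := by rw [pow_succ _ (n + 1), mul_assoc]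
  have hlist : ∀ l : List G, (l.map fun h => ρ h - 1).prod ∈ (𝒟 * 𝒢) ^ l.length := by
    intro l
    induction l with
    | nil => exact Submodule.one_le.mp (le_of_eq (pow_zero _).symm)
    | cons a l ih =>
      rw [List.map_cons, List.prod_cons, List.length_cons, pow_succ']
      exact Submodule.mul_mem_mul (hmem a) ih
  have h1 := hlist l
  obtain ⟨n, hn⟩ : ∃ n, Lf p k d = n + 1 := ⟨Lf p k d - 1, by unfold Lf; omega⟩
  rw [hl, hn] at h1
  have h2 := hpow n h1
  rw [← hn, hN, Submodule.bot_mul] at h2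
  exact (Submodule.mem_bot ℤ).mp h2

end Rep
end D8P


namespace D8P

theorem mkRep {G : Type*} [Group G] {D : D8S G} {p : ℕ} {E : Type*} [Ring E] {ρ : G →* E}
    (hp : Odd p) (h0 : (p : E) = 0) (A B : E) (hA : A * A = 1) (hB : B * B = 1)
    (hAB : A * B = B * A) (hs : (1 + A) * (1 + B) = 0)
    (iA : ∀ g, A * ρ g = ρ (D.a g) * A) (iB : ∀ g, B * ρ g = ρ (D.b g) * B)
    (fa : ∀ x, D.a x = x → ρ x * (1 + A) = 1 + A)
    (fb : ∀ x, D.b x = x → ρ x * (1 + B) = 1 + B)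
    (fz : ∀ x, D.z x = x → ρ x * (1 + A * B) = 1 + A * B) :
    ∃ π, Rep D p ρ π := by
  obtain ⟨k, hk⟩ := hp
  set h : E := -(k : E) with hh
  have hc : ∀ x : E, h * x = x * h := fun x => by
    rw [hh, neg_mul, mul_neg, (Nat.cast_commute k x).eq]
  have h2 : 2 * h = 1 := by
    have : (2 * (k : E) + 1) = 0 := by rw [← h0, hk]; push_cast; rfl
    rw [hh, mul_neg]; exact (eq_neg_of_add_eq_zero_right this).symm
  have h2' : h + h = 1 := by rw [← two_mul, h2]
  have hz : A * B = -(1 + A + B) := by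
    have : 1 + A + B + A * B = 0 := by rw [← hs]; noncomm_ring
    exact eq_neg_of_add_eq_zero_right this
  have hz2 : B * A = -(1 + A + B) := by rw [← hAB, hz]
  have e : ∀ x y : E, (h * x) * (h * y) = h * h * (x * y) := fun x y => by
    rw [mul_assoc, ← mul_assoc x h y, ← hc x]; noncomm_ring
  have id : ∀ X : E, X * X = 1 → (h * (1 + X)) * (h * (1 + X)) = h * (1 + X) := by
    intro X hX
    rw [e]
    have : (1 + X) * (1 + X) = 2 * (1 + X) := by
      have : (1 + X) * (1 + X) = 1 + X + X + X * X := by noncomm_ring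
      rw [this, hX, two_mul]; abel
    rw [this, mul_assoc, ← mul_assoc h 2, hc 2, h2, one_mul]
  have hm : ∀ X : E, 2 * (h * (1 + X)) - 1 = X := by
    intro X
    rw [← mul_assoc, h2, one_mul]; abel
  have hzz : (A * B) * (A * B) = 1 := by
    rw [mul_assoc, ← mul_assoc B A B, ← hAB, mul_assoc A B B, hB, mul_one, hA]
  have hs' : (1 + B) * (1 + A) = 0 := by
    rw [← hs]; simp only [mul_add, add_mul, one_mul, mul_one, hAB]; abel
  have haz : (1 + A) * (1 + A * B) = 0 := by
    have : (1 + A) * (1 + A * B) = (1 + A) * (1 + B) := by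
      simp only [mul_add, add_mul, one_mul, mul_one, ← mul_assoc, hA]; abel
    rw [this, hs]
  have hza : (1 + A * B) * (1 + A) = 0 := by
    have : (1 + A * B) * (1 + A) = (1 + B) * (1 + A) := by
      have : A * B * A = B := by rw [hAB, mul_assoc, hA, mul_one]
      simp only [mul_add, add_mul, one_mul, mul_one, this]; rw [hAB]; abel
    rw [this, hs']
  have hzb : (1 + A * B) * (1 + B) = 0 := by
    have : (1 + A * B) * (1 + B) = (1 + A) * (1 + B) := by
      simp only [mul_add, add_mul, one_mul, mul_one, mul_assoc, hB]; abel
    rw [this, hs]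
  have hbz : (1 + B) * (1 + A * B) = 0 := by
    have : (1 + B) * (1 + A * B) = (1 + B) * (1 + A) := by
      have : B * (A * B) = A := by rw [hAB, ← mul_assoc, hB, one_mul]
      simp only [mul_add, add_mul, one_mul, mul_one, this]; rw [hAB]; abel
    rw [this, hs']
  refine ⟨![h * (1 + A), h * (1 + B), h * (1 + A * B)], h0, ?_, ?_, ?_, ?_, ?_⟩
  · intro u v huv
    fin_cases u <;> fin_cases v <;> simp [e, hs, hs', haz, hza, hzb, hbz] at huv ⊢
  · intro v
    fin_cases v
    · exact id A hA
    · exact id B hB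
    · exact id _ hzz
  · change h * (1 + A) + h * (1 + B) + h * (1 + A * B) = 1
    rw [← mul_add, ← mul_add, hz]
    have : 1 + A + (1 + B) + (1 + -(1 + A + B)) = 2 := by
      have : (2 : E) = 1 + 1 := by norm_num
      rw [this]; abel
    rw [this, hc, h2]
  · intro v g
    fin_cases v
    · change (2 * (h * (1 + A)) - 1) * _ = ρ (D.a g) * (2 * (h * (1 + A)) - 1)
      rw [hm, iA]
    · change (2 * (h * (1 + B)) - 1) * _ = ρ (D.b g) * (2 * (h * (1 + B)) - 1)
      rw [hm, iB]
    · change (2 * (h * (1 + A * B)) - 1) * _ = ρ (D.z g) * (2 * (h * (1 + A * B)) - 1)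
      rw [hm, mul_assoc, iB, ← mul_assoc, iA, mul_assoc, D.z_def]
  · intro v m hv
    fin_cases v
    · change ρ m * (h * (1 + A)) = (h * (1 + A))
      rw [← mul_assoc, ← hc, mul_assoc, fa m hv]
    · change ρ m * (h * (1 + B)) = (h * (1 + B))
      rw [← mul_assoc, ← hc, mul_assoc, fb m hv]
    · change ρ m * (h * (1 + A * B)) = (h * (1 + A * B))
      rw [← mul_assoc, ← hc, mul_assoc, fz m hv]

section
variable {G : Type*} [Group G] (D : D8S G) {p : ℕ} [Finite G] (ho : Odd (Nat.card G))
  (hp2 : Odd p)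
  (hp : p.Prime) (hG : IsPGroup p G) (k : ℕ) (hq : ∀ c, D.s c = c → c ^ p ^ k = 1)
  (S : Finset G) (hS : ∀ g ∈ S, D.a g = g ∨ D.b g = g) (d : ℕ) (hd : S.card ≤ d)
  (hcl : Subgroup.closure (S : Set G) = ⊤)
include ho hp2 hp hG hq hS hd hcl

theorem ring_nil1 {E : Type*} [Ring E] {ρ : G →* E}
    (A B : E) (hA : A * A = 1) (hB : B * B = 1)
    (hAB : A * B = B * A) (hs : (1 + A) * (1 + B) = 0)
    (iA : ∀ g, A * ρ g = ρ (D.a g) * A) (iB : ∀ g, B * ρ g = ρ (D.b g) * B)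
    (fa : ∀ x, D.a x = x → ρ x * (1 + A) = 1 + A)
    (fb : ∀ x, D.b x = x → ρ x * (1 + B) = 1 + B)
    (fz : ∀ x, D.z x = x → ρ x * (1 + A * B) = 1 + A * B)
    (l : List G) (hl : l.length = Lf p k d) :
    ∃ t : E, (l.map fun h => ρ h - 1).prod = p * t := by
  let J : Ideal E := Ideal.span {(p : E)}
  have : J.IsTwoSided := by
    refine ⟨?_⟩
    intro x y hx
    obtain ⟨t, rfl⟩ := Ideal.mem_span_singleton'.1 hx
    refine Ideal.mem_span_singleton'.2 ⟨t * y, ?_⟩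
    rw [mul_assoc, mul_assoc, (Nat.cast_commute p y).eq]
  let f := Ideal.Quotient.mk J
  have h0 : ((p : ℕ) : E ⧸ J) = 0 := by
    rw [← map_natCast f p]
    exact Ideal.Quotient.eq_zero_iff_mem.2 (Ideal.subset_span rfl)
  obtain ⟨π, I⟩ := mkRep (D := D) (ρ := (f : E →* E ⧸ J).comp ρ) hp2 h0 (f A) (f B)
    (by rw [← map_mul, hA, map_one]) (by rw [← map_mul, hB, map_one])
    (by rw [← map_mul, hAB, map_mul])
    (by rw [← map_one f, ← map_add, ← map_add, ← map_mul, hs, map_zero])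
    (fun g => by
      change f A * f (ρ g) = f (ρ (D.a g)) * f A
      rw [← map_mul, iA, map_mul])
    (fun g => by
      change f B * f (ρ g) = f (ρ (D.b g)) * f B
      rw [← map_mul, iB, map_mul])
    (fun g h => by
      change f (ρ g) * _ = _
      rw [← map_one f, ← map_add, ← map_mul, fa g h])
    (fun g h => by
      change f (ρ g) * _ = _
      rw [← map_one f, ← map_add, ← map_mul, fb g h])
    (fun g h => by
      change f (ρ g) * _ = _
      rw [← map_one f, ← map_mul, ← map_add, ← map_mul, fz g h])
  have := I.list_nil ho hp2 hp hG k hq S hS d hd hcl l hl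
  have h2 : f ((l.map fun h => ρ h - 1).prod) = 0 := by
    rw [← this, map_list_prod, List.map_map]
    congr 2
  obtain ⟨t, ht⟩ := Ideal.mem_span_singleton'.1 (Ideal.Quotient.eq_zero_iff_mem.1 h2)
  exact ⟨t, by rw [← ht, (Nat.cast_commute p t).eq]⟩

theorem ring_nil {E : Type*} [Ring E] {ρ : G →* E}
    (A B : E) (hA : A * A = 1) (hB : B * B = 1)
    (hAB : A * B = B * A) (hs : (1 + A) * (1 + B) = 0)
    (iA : ∀ g, A * ρ g = ρ (D.a g) * A) (iB : ∀ g, B * ρ g = ρ (D.b g) * B)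
    (fa : ∀ x, D.a x = x → ρ x * (1 + A) = 1 + A)
    (fb : ∀ x, D.b x = x → ρ x * (1 + B) = 1 + B)
    (fz : ∀ x, D.z x = x → ρ x * (1 + A * B) = 1 + A * B) (j : ℕ) :
    ∀ (l : List G) (_ : l.length = j * Lf p k d),
    ∃ t : E, (l.map fun h => ρ h - 1).prod = (p ^ j : ℕ) * t := by
  induction j with
  | zero => intro l hl; exact ⟨_, by simp; rfl⟩
  | succ j ih =>
    intro l hl
    obtain ⟨t, ht⟩ := ih (l.drop (Lf p k d)) (by
      rw [List.length_drop, hl, add_mul, one_mul, Nat.add_sub_cancel])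
    obtain ⟨t', ht'⟩ := ring_nil1 D ho hp2 hp hG k hq S hS d hd hcl A B hA hB hAB hs iA iB fa fb fz
      (l.take (Lf p k d)) (by
        rw [List.length_take, hl, add_mul, one_mul]; omega)
    refine ⟨t' * t, ?_⟩
    rw [← List.take_append_drop (Lf p k d) l, List.map_append, List.prod_append, ht, ht']
    rw [pow_succ', Nat.cast_mul, mul_assoc, ← mul_assoc t', ← (Nat.cast_commute (p^j) t').eq]
    simp only [mul_assoc]
end

end D8P


namespace D8P

theorem exists_addcomm {G : Type u} [Group G] (N : Subgroup G)
    (hc : ∀ x ∈ N, ∀ y ∈ N, x * y = y * x) :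
    ∃ (M : Type u) (_ : AddCommGroup M) (i : M → G), Function.Injective i ∧
      (∀ x y, i (x + y) = i x * i y) ∧ (∀ g, g ∈ N ↔ ∃ x, i x = g) := by
  let _ : CommGroup N := { (inferInstance : Group N) with
    mul_comm := fun x y => Subtype.ext (hc x x.2 y y.2) }
  refine ⟨Additive N, inferInstance, fun x => ((Additive.toMul x : N) : G), ?_, ?_, ?_⟩
  · intro x y h
    exact Additive.toMul.injective (Subtype.ext h)
  · intro x y; rfl
  · intro g
    exact ⟨fun h => ⟨Additive.ofMul ⟨g, h⟩, rfl⟩, fun ⟨x, hx⟩ => hx ▸ (Additive.toMul x).2⟩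

section
variable {M : Type*} [AddCommGroup M]
theorem end_mul (f g : AddMonoid.End M) (x : M) : (f * g) x = f (g x) := rfl
theorem end_add (f g : AddMonoid.End M) (x : M) : (f + g) x = f x + g x := rfl
theorem end_one (x : M) : (1 : AddMonoid.End M) x = x := rfl
theorem end_zero (x : M) : (0 : AddMonoid.End M) x = 0 := rfl
theorem end_nat (n : ℕ) (x : M) : (n : AddMonoid.End M) x = n • x := rfl
end

/-- iterated commutation -/
def itc {G : Type*} [Group G] (l : List G) (n : G) : G :=
  l.foldr (fun h x => h * x * h⁻¹ * x⁻¹) n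

section
variable {G : Type*} [Group G] (D : D8S G) {p : ℕ} [Finite G] (ho : Odd (Nat.card G))
  (hp2 : Odd p)
  (hp : p.Prime) (hG : IsPGroup p G) (k : ℕ) (hq : ∀ c, D.s c = c → c ^ p ^ k = 1)
  (S : Finset G) (hS : ∀ g ∈ S, D.a g = g ∨ D.b g = g) (d : ℕ) (hd : S.card ≤ d)
  (hcl : Subgroup.closure (S : Set G) = ⊤)
include ho hp2 hp hG hq hS hd hcl

theorem itc_pow (N : Subgroup G) [N.Normal] (hc : ∀ x ∈ N, ∀ y ∈ N, x * y = y * x)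
    (hNa : ∀ x ∈ N, D.a x ∈ N) (hNb : ∀ x ∈ N, D.b x ∈ N) (j : ℕ) (l : List G)
    (hl : l.length = j * Lf p k d) (n : G) (hn : n ∈ N) :
    ∃ t ∈ N, itc l n = t ^ p ^ j := by
  obtain ⟨M, _, i, hi, hadd, hr⟩ := exists_addcomm N hc
  have i0 : i 0 = 1 := by
    have := hadd 0 0
    rw [add_zero] at this
    exact mul_eq_left.1 this.symm
  have ineg : ∀ x, i (-x) = (i x)⁻¹ := fun x => by
    rw [eq_inv_iff_mul_eq_one, ← hadd, neg_add_cancel, i0]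
  have inat : ∀ (m : ℕ) x, i (m • x) = i x ^ m := by
    intro m x
    induction m with
    | zero => simp [i0]
    | succ m ih => rw [succ_nsmul, hadd, ih, pow_succ]
  have mem : ∀ x, i x ∈ N := fun x => (hr _).2 ⟨x, rfl⟩
  have key : ∀ f : G →* G, (∀ x ∈ N, f x ∈ N) → ∃ F : AddMonoid.End M, ∀ x, i (F x) = f (i x) := by
    intro f hf
    choose F hF using fun x => (hr _).1 (hf (i x) (mem x))
    refine ⟨AddMonoidHom.mk' F ?_, hF⟩
    intro x y
    apply hi
    rw [hadd, hF, hF, hF, hadd, map_mul]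
  obtain ⟨A, hA⟩ := key D.a hNa
  obtain ⟨B, hB⟩ := key D.b hNb
  choose R hR using fun g => key (MulAut.conj g).toMonoidHom
    (fun x hx => by simpa using (inferInstance : N.Normal).conj_mem x hx g)
  have hR' : ∀ g x, i (R g x) = g * i x * g⁻¹ := fun g x => by rw [hR]; simp
  let ρ : G →* AddMonoid.End M :=
    { toFun := R
      map_one' := by
        ext x; apply hi; rw [hR']; simp
      map_mul' := by
        intro g h
        ext x; apply hi
        rw [hR', end_mul, hR', hR']; group }
  have hρ : ∀ g x, i (ρ g x) = g * i x * g⁻¹ := hR'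
  have cm : ∀ x y, i x * i y = i y * i x := fun x y => hc _ (mem x) _ (mem y)
  have hcomm : ∀ {g x : G}, g * x = x * g → g * x * g⁻¹ = x := fun h => by
    rw [h, mul_inv_cancel_right]
  obtain ⟨t, ht⟩ := ring_nil D ho hp2 hp hG k hq S hS d hd hcl (ρ := ρ) A B
    (by ext x; apply hi; simp [hA, D.aa]) (by ext x; apply hi; simp [hB, D.bb])
    (by ext x; apply hi; simp [hA, hB, D.ab])
    (by
      ext x; apply hi
      simp only [end_mul, end_add, end_one, end_zero, map_add]
      rw [i0]
      have e : i (x + B x + (A x + A (B x))) = i x * D.b (i x) * (D.a (i x) * D.a (D.b (i x))) := by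
        simp only [hadd, hA, hB]
      apply D.fix
      · rw [← hA]; congr 1; simp only [map_add]
        have : ∀ y, A (A y) = y := fun y => hi (by simp [hA, D.aa])
        rw [this, this]; abel
      · rw [← hB]; congr 1; simp only [map_add]
        have : ∀ y, B (B y) = y := fun y => hi (by simp [hB, D.bb])
        have h2 : ∀ y, A (B y) = B (A y) := fun y => hi (by simp [hA, hB, D.ab])
        rw [h2, this, this]; abel)
    (by intro g; ext x; apply hi; simp [hA, hρ])
    (by intro g; ext x; apply hi; simp [hB, hρ])
    (by
      intro g hg; ext x; apply hi
      simp only [end_mul, end_add, end_one]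
      rw [hρ]
      apply hcomm
      apply D.comm_a ho _ _ hg
      rw [hadd, map_mul, hA, D.aa, ← hA, cm])
    (by
      intro g hg; ext x; apply hi
      simp only [end_mul, end_add, end_one]
      rw [hρ]
      apply hcomm
      apply D.comm_b ho _ _ hg
      rw [hadd, map_mul, hB, D.bb, ← hB, cm])
    (by
      intro g hg; ext x; apply hi
      simp only [end_mul, end_add, end_one]
      rw [hρ]
      apply hcomm
      apply D.comm_z ho _ _ hg
      have e : i (A (B x)) = D.z (i x) := by rw [hA, hB, D.z_def]
      rw [hadd, map_mul, e, D.zz, ← e, cm]) j l hl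
  obtain ⟨x, rfl⟩ := (hr n).1 hn
  refine ⟨i (t x), mem _, ?_⟩
  have hl : ∀ l : List G, i ((l.map fun h => ρ h - 1).prod x) = itc l (i x) := by
    intro l
    induction l with
    | nil => simp [itc]
    | cons h l ih =>
      rw [List.map_cons, List.prod_cons, end_mul]
      change i (ρ h _ - _) = h * itc l (i x) * h⁻¹ * (itc l (i x))⁻¹
      rw [← ih, sub_eq_add_neg, hadd, hρ, ineg]
      rfl
  rw [← hl, ht, end_mul, end_nat, inat]

omit hp2 hp hG hS hd hcl S d in
theorem pow_central (N : Subgroup G) [N.Normal] (hc : ∀ x ∈ N, ∀ y ∈ N, x * y = y * x)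
    (hNa : ∀ x ∈ N, D.a x ∈ N) (hNb : ∀ x ∈ N, D.b x ∈ N) (hNs : ∀ x ∈ N, D.s x ∈ N)
    (n : G) (hn : n ∈ N) (x : G) : x * n ^ p ^ k = n ^ p ^ k * x := by
  set q := p ^ k
  have cp : ∀ {u v : G}, u ∈ N → v ∈ N → (u * v) ^ q = u ^ q * v ^ q := fun hu hv =>
    (show Commute _ _ from hc _ hu _ hv).mul_pow q
  have ha : ∀ n ∈ N, D.a n = n → n ^ q = 1 := by
    intro n hn h
    have h1 : (n * D.s n) ^ q = 1 := hq _ (by rw [map_mul, D.ss, hc _ (hNs n hn) _ hn])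
    rw [cp hn (hNs n hn)] at h1
    have h2 : n ^ q = (D.s n ^ q)⁻¹ := eq_inv_of_mul_eq_one_left h1
    apply D.fix
    · rw [map_pow, h]
    · rw [h2, map_inv, map_pow, ← D.sa, h]
  have hb : ∀ n ∈ N, D.b n = n → n ^ q = 1 := by
    intro n hn h
    have := ha (D.s n) (hNs n hn) (by rw [← D.sb, h])
    rw [← map_pow] at this
    rw [← D.ss (n ^ q), this, map_one]
  have hz : ∀ n ∈ N, D.z (n ^ q) = n ^ q := by
    intro n hn
    have hNz : ∀ x ∈ N, D.z x ∈ N := fun x hx => hNa _ (hNb x hx)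
    set w := n * (D.z n)⁻¹ with hw
    have wN : w ∈ N := mul_mem hn (inv_mem (hNz n hn))
    have zw : D.z w = w⁻¹ := by rw [hw, map_mul, map_inv, D.zz]; group
    have h1 : (w * D.a w) ^ q = 1 := ha _ (mul_mem wN (hNa w wN)) (by
      rw [map_mul, D.aa, hc _ (hNa w wN) _ wN])
    have h2 : (w * (D.a w)⁻¹) ^ q = 1 := hb _ (mul_mem wN (inv_mem (hNa w wN))) (by
      have e1 : D.b w = (D.a w)⁻¹ := by rw [← D.az, zw, map_inv]
      have e2 : D.b (D.a w) = w⁻¹ := by rw [← D.ab, ← D.z_def, zw]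
      rw [map_mul, map_inv, e1, e2, inv_inv, hc _ (inv_mem (hNa w wN)) _ wN])
    have h3 : (w * w) ^ q = 1 := by
      have : w * w = (w * D.a w) * (w * (D.a w)⁻¹) := by
        rw [show w * D.a w * (w * (D.a w)⁻¹) = w * (D.a w * w) * (D.a w)⁻¹ by group,
          hc _ (hNa w wN) _ wN]
        group
      rw [this, cp (mul_mem wN (hNa w wN)) (mul_mem wN (inv_mem (hNa w wN))), h1, h2, one_mul]
    rw [cp wN wN] at h3
    have h4 := eq_one_of_sq ho h3
    rw [hw, cp hn (inv_mem (hNz n hn)), inv_pow, mul_inv_eq_one] at h4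
    rw [map_pow, ← h4]
  -- general commuting
  have com : ∀ x, D.z x = x⁻¹ → x * n ^ q = n ^ q * x := by
    intro x hx
    have h1 := hz _ ((inferInstance : N.Normal).conj_mem n hn x)
    have h0 := hz n hn
    rw [conj_pow, map_mul, map_mul, map_inv, hx, h0, inv_inv] at h1
    -- x⁻¹ m x = x m x⁻¹
    have h2 : Commute (x * x) (n ^ q) := by
      show x * x * n ^ q = n ^ q * (x * x)
      calc x * x * n ^ q = x * (x * n ^ q * x⁻¹) * x := by group
        _ = x * (x⁻¹ * n ^ q * x) * x := by rw [h1]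
        _ = _ := by group
    have h3 : Commute (sq (x * x)) (n ^ q) := h2.pow_left _
    rw [sq_uniq ho rfl] at h3
    exact h3
  obtain ⟨u, v, m, rfl, hu, hv, hm⟩ := D.xym ho x
  have c1 : Commute u (n ^ q) := com u (D.z_a ho u hu)
  have c2 : Commute v (n ^ q) := com v (D.z_b ho v hv)
  have c3 : Commute m (n ^ q) := D.comm_z ho _ _ hm (hz n hn)
  exact (c1.mul_left c2).mul_left c3

/-- class bound for abelian part -/
def mf (p k d : ℕ) : ℕ := k * Lf p k d + 1

omit [Finite G] ho hp2 hp hG hq hS hd hcl in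
theorem mem_ucs_of_itc (m : ℕ) : ∀ n : G, (∀ l : List G, l.length = m → itc l n = 1) →
    n ∈ Subgroup.upperCentralSeries G m := by
  induction m with
  | zero => intro n h; simpa [itc] using h [] rfl
  | succ m ih =>
    intro n h
    rw [Subgroup.mem_upperCentralSeries_succ_iff]
    intro y
    have : n * y * n⁻¹ * y⁻¹ = (y * n * y⁻¹ * n⁻¹)⁻¹ := by group
    rw [commutatorElement_def, this]
    apply inv_mem
    apply ih
    intro l hl
    have := h (l ++ [y]) (by simp [hl])
    simpa [itc] using this

theorem le_ucs (N : Subgroup G) [N.Normal] (hc : ∀ x ∈ N, ∀ y ∈ N, x * y = y * x)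
    (hNa : ∀ x ∈ N, D.a x ∈ N) (hNb : ∀ x ∈ N, D.b x ∈ N) (hNs : ∀ x ∈ N, D.s x ∈ N) :
    N ≤ Subgroup.upperCentralSeries G (mf p k d) := by
  intro n hn
  apply mem_ucs_of_itc
  intro l hl
  cases l with
  | nil => simp [mf] at hl
  | cons h l =>
    obtain ⟨t, ht, e⟩ := itc_pow D ho hp2 hp hG k hq S hS d hd hcl N hc hNa hNb k l
      (by simpa [mf] using hl) n hn
    change h * itc l n * h⁻¹ * (itc l n)⁻¹ = 1
    rw [e, pow_central D ho k hq N hc hNa hNb hNs t ht h]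
    group

end

end D8P


namespace D8P
open scoped commutatorElement

theorem three_sub {G : Type*} [Group G] (N H₁ H₂ H₃ : Subgroup G) [N.Normal]
    (h1 : ⁅⁅H₂, H₃⁆, H₁⁆ ≤ N) (h2 : ⁅⁅H₃, H₁⁆, H₂⁆ ≤ N) : ⁅⁅H₁, H₂⁆, H₃⁆ ≤ N := by
  have key : ∀ X : Subgroup G, X ≤ N ↔ X.map (QuotientGroup.mk' N) = ⊥ := fun X => by
    rw [Subgroup.map_eq_bot_iff, QuotientGroup.ker_mk']
  rw [key] at *
  simp only [Subgroup.map_commutator] at *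
  exact Subgroup.commutator_commutator_eq_bot_of_rotate h1 h2

theorem lcs_ucs {G : Type*} [Group G] (i : ℕ) : ∀ t,
    ⁅(⊤ : Subgroup G).lowerCentralSeries i, Subgroup.upperCentralSeries G (i + 1 + t)⁆ ≤
      Subgroup.upperCentralSeries G t := by
  induction i with
  | zero =>
    intro t
    rw [Subgroup.commutator_comm, Nat.zero_add, add_comm 1 t]
    exact Subgroup.commutator_upperCentralSeries_top_le G t
  | succ i ih =>
    intro t
    rw [Subgroup.lowerCentralSeries_succ]
    apply three_sub
    · have h : ⁅(⊤ : Subgroup G), Subgroup.upperCentralSeries G (i + 1 + 1 + t)⁆ ≤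
          Subgroup.upperCentralSeries G (i + 1 + t) := by
        rw [Subgroup.commutator_comm, show i + 1 + 1 + t = (i + 1 + t) + 1 by omega]
        exact Subgroup.commutator_upperCentralSeries_top_le G _
      refine le_trans (Subgroup.commutator_mono h le_rfl) ?_
      rw [Subgroup.commutator_comm]; exact ih t
    · have h : ⁅Subgroup.upperCentralSeries G (i + 1 + 1 + t),
          (⊤ : Subgroup G).lowerCentralSeries i⁆ ≤ Subgroup.upperCentralSeries G (t + 1) := by
        rw [Subgroup.commutator_comm, show i + 1 + 1 + t = i + 1 + (t + 1) by omega]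
        exact ih (t + 1)
      exact le_trans (Subgroup.commutator_mono h le_rfl)
        (Subgroup.commutator_upperCentralSeries_top_le G _)

theorem char_inv {G : Type*} [Group G] (σ : G →* G) (h : ∀ x, σ (σ x) = x) (H : Subgroup G)
    [H.Characteristic] (x : G) (hx : x ∈ H) : σ x ∈ H := by
  let e : G ≃* G := { σ with invFun := σ, left_inv := h, right_inv := h }
  have := Subgroup.characteristic_iff_comap_eq.1 (inferInstance : H.Characteristic) e
  rw [← this] at hx
  exact hx

theorem pow_lcs_step {G : Type*} [Group G] (q : ℕ) (hq : ∀ g : G, g ^ q ∈ commutator G) (i : ℕ) :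
    ∀ t ∈ (⊤ : Subgroup G).lowerCentralSeries i, t ^ q ∈ (⊤ : Subgroup G).lowerCentralSeries (i + 1) := by
  induction i with
  | zero => intro t _; exact hq t
  | succ i ih =>
    intro t ht
    set L := (⊤ : Subgroup G).lowerCentralSeries (i + 1 + 1) with hL
    have : L.Normal := inferInstance
    let f := QuotientGroup.mk' L
    have fk : ∀ g, f g = 1 ↔ g ∈ L := fun g => QuotientGroup.eq_one_iff g
    have cen : ∀ u ∈ (⊤ : Subgroup G).lowerCentralSeries (i + 1), ∀ g, Commute (f u) (f g) := by
      intro u hu g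
      have : f ⁅u, g⁆ = 1 := (fk _).2 (Subgroup.commutator_mem_commutator hu (Subgroup.mem_top g))
      rw [map_commutatorElement, commutatorElement_eq_one_iff_mul_comm] at this
      exact this
    rw [← fk, map_pow]
    have ht' := ht
    rw [Subgroup.mem_lowerCentralSeries_succ_iff] at ht'
    induction ht' using Subgroup.closure_induction with
    | mem x hx =>
      obtain ⟨u, hu, h, -, rfl⟩ := hx
      set c := f ⁅u, h⁆ with hc
      have cc : ∀ g, Commute c (f g) := cen _ ht
      have e1 : f h * f u * (f h)⁻¹ = c⁻¹ * f u := by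
        rw [hc, map_commutatorElement, commutatorElement_def]; group
      have e2 : f h * f u ^ q * (f h)⁻¹ = (c ^ q)⁻¹ * f u ^ q := by
        rw [← conj_pow, e1, (cc u).inv_left.mul_pow, inv_pow]
      have e3 : Commute (f u ^ q) (f h) := by
        rw [← map_pow]; exact cen _ (ih u hu) h
      rw [← e3.eq, mul_inv_cancel_right] at e2
      exact inv_eq_one.1 (mul_eq_right.1 e2.symm)
    | one => simp
    | mul x y hx hy ihx ihy =>
      have hx' : x ∈ (⊤ : Subgroup G).lowerCentralSeries (i + 1) := hx
      have hy' : y ∈ (⊤ : Subgroup G).lowerCentralSeries (i + 1) := hy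
      rw [map_mul, (cen x hx' y).mul_pow, ihx hx', ihy hy', one_mul]
    | inv x hx ihx =>
      have hx' : x ∈ (⊤ : Subgroup G).lowerCentralSeries (i + 1) := hx
      rw [map_inv, inv_pow, ihx hx', inv_one]

theorem pow_lcs {G : Type*} [Group G] (q : ℕ) (hq : ∀ g : G, g ^ q ∈ commutator G) (g : G) (n : ℕ) :
    g ^ q ^ n ∈ (⊤ : Subgroup G).lowerCentralSeries n := by
  induction n with
  | zero => simp
  | succ n ih =>
    rw [pow_succ, pow_mul]
    exact pow_lcs_step q hq n _ ih

/-- exponent bound for a group generated by `d` nice elements -/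
def Fd (p k d : ℕ) : ℕ := (p ^ k) ^ (2 * mf p k d)

section
variable {G : Type*} [Group G] (D : D8S G) {p : ℕ} [Finite G] (ho : Odd (Nat.card G))
  (hp2 : Odd p)
  (hp : p.Prime) (hG : IsPGroup p G) (k : ℕ) (hq : ∀ c, D.s c = c → c ^ p ^ k = 1)
  (S : Finset G) (hS : ∀ g ∈ S, D.a g = g ∨ D.b g = g) (d : ℕ) (hd : S.card ≤ d)
  (hcl : Subgroup.closure (S : Set G) = ⊤)
include ho hp2 hp hG hq hS hd hcl

theorem class_bd : (⊤ : Subgroup G).lowerCentralSeries (2 * mf p k d) = ⊥ := by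
  set m := mf p k d with hm
  have : Fact p.Prime := ⟨hp⟩
  have hn : Group.IsNilpotent G := hG.isNilpotent
  let Z := Subgroup.upperCentralSeries G
  let C := Subgroup.centralizer (Z (m + 1) : Set G)
  let N := C ⊓ Z (m + 1)
  have inv : ∀ σ : G →* G, (∀ x, σ (σ x) = x) → ∀ x ∈ N, σ x ∈ N := fun σ h x hx =>
    ⟨char_inv σ h C x hx.1, char_inv σ h (Z (m + 1)) x hx.2⟩
  have hN : N ≤ Z m := le_ucs D ho hp2 hp hG k hq S hS d hd hcl N
    (fun x hx y hy => ((Subgroup.mem_centralizer_iff.1 hx.1) y hy.2).symm) (inv _ D.aa) (inv _ D.bb)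
      (inv _ D.ss)
  have hC : ∀ i, C ⊓ Z i ≤ Z m := by
    intro i
    induction i with
    | zero =>
      intro x hx
      have : x = 1 := by simpa [Z] using hx.2
      rw [this]; exact one_mem _
    | succ i ih =>
      intro x hx
      refine hN ⟨hx.1, ?_⟩
      refine Subgroup.mem_upperCentralSeries_succ_iff.2 fun y => ih ⟨?_, ?_⟩
      · have := mul_mem hx.1 ((inferInstance : C.Normal).conj_mem _ (inv_mem hx.1) y)
        rwa [commutatorElement_def, show x * y * x⁻¹ * y⁻¹ = x * (y * x⁻¹ * y⁻¹) by group]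
      · exact Subgroup.mem_upperCentralSeries_succ_iff.1 hx.2 y
  have hC' : C ≤ Z m := by
    obtain ⟨i, hi⟩ := hn.nilpotent
    have := hC i
    rwa [show Z i = ⊤ from hi, inf_top_eq] at this
  have h1 : (⊤ : Subgroup G).lowerCentralSeries m ≤ C := by
    have := lcs_ucs (G := G) m 0
    rw [Subgroup.upperCentralSeries_zero, le_bot_iff,
      Subgroup.commutator_eq_bot_iff_le_centralizer] at this
    exact this
  have h2 : ∀ j ≤ m, (⊤ : Subgroup G).lowerCentralSeries (m + j) ≤ Z (m - j) := by
    intro j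
    induction j with
    | zero => intro _; exact h1.trans hC'
    | succ j ih =>
      intro hj
      rw [← add_assoc, Subgroup.lowerCentralSeries_succ]
      refine (Subgroup.commutator_mono (ih (by omega)) le_rfl).trans ?_
      rw [show m - j = (m - (j + 1)) + 1 by omega]
      exact Subgroup.commutator_upperCentralSeries_top_le G _
  have := h2 m le_rfl
  rw [Nat.sub_self, ← two_mul] at this
  exact le_bot_iff.1 this

omit hp2 hp hG hd d in
theorem pow_comm (g : G) : g ^ p ^ k ∈ commutator G := by
  set q := p ^ k
  let f := (Abelianization.of : G →* Abelianization G)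
  have fk : ∀ g, g ∈ commutator G ↔ f g = 1 := fun g => by
    rw [← Abelianization.ker_of, MonoidHom.mem_ker]
  have fm : ∀ (σ : G →* G) g, f g = 1 → f (σ g) = 1 := by
    intro σ g h
    have : f (σ g) = Abelianization.map σ (f g) := rfl
    rw [this, h, map_one]
  have ha : ∀ x, D.a x = x → f x ^ q = 1 := by
    intro x hx
    set g := x * D.s x with hg
    set r := sq (g⁻¹ * D.s g) with hr
    have hrr : r * r = g⁻¹ * D.s g := sq_mul_self ho _
    have hsr : D.s r = r⁻¹ := by
      rw [hr, sq_map, ← sq_inv, map_mul, map_inv, D.ss, mul_inv_rev, inv_inv]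
    have h1 : (g * r) ^ q = 1 := hq _ (by
      rw [map_mul, hsr, show D.s g = g * (r * r) by rw [hrr]; group]; group)
    have h2 : f r = 1 := by
      rw [← fk]
      apply sq_mem
      rw [fk, hg, map_mul D.s, D.ss]
      simp only [map_mul, map_inv]
      rw [mul_comm (f (D.s x)), inv_mul_cancel]
    have h3 : f (g ^ q) = 1 := by
      rw [map_pow, ← mul_one (f g), ← h2, ← map_mul, ← map_pow, h1, map_one, h2]
    have h4 := fm D.a _ h3
    have e : D.a g = x * (D.s x)⁻¹ := by
      rw [hg, map_mul, hx, ← D.sb, D.b_a ho x hx, map_inv]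
    rw [map_pow, e, map_pow] at h4
    rw [hg, map_pow] at h3
    have h5 : f ((x ^ q) * (x ^ q)) = 1 := by
      have : f ((x ^ q) * (x ^ q)) = f (x * D.s x) ^ q * f (x * (D.s x)⁻¹) ^ q := by
        simp only [map_mul, map_pow, map_inv, mul_pow, inv_pow]
        rw [mul_mul_mul_comm, mul_inv_cancel, mul_one]
      rw [this, h3, h4, one_mul]
    rw [← fk] at h5
    have h6 := sq_mem h5
    rw [sq_uniq ho rfl, fk, map_pow] at h6
    exact h6
  have hb : ∀ x, D.b x = x → f x ^ q = 1 := by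
    intro x hx
    have := ha (D.s x) (by rw [← D.sb, hx])
    rw [← map_pow] at this
    have h2 := fm D.s _ this
    rwa [map_pow, D.ss, map_pow] at h2
  let K : Subgroup G := ((powMonoidHom q : Abelianization G →* Abelianization G).comp f).ker
  have hK : (⊤ : Subgroup G) ≤ K := by
    rw [← hcl, Subgroup.closure_le]
    intro x hx
    rcases hS x hx with h | h
    · exact ha x h
    · exact hb x h
  rw [fk, map_pow]
  exact hK (Subgroup.mem_top g)

theorem class_exp (g : G) : g ^ Fd p k d = 1 := by
  have h := pow_lcs (p ^ k) (pow_comm D ho k hq S hS hcl) g (2 * mf p k d)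
  rw [class_bd D ho hp2 hp hG k hq S hS d hd hcl] at h
  exact h

end

end D8P


namespace D8P
open scoped commutatorElement

/-- restriction of the action to an invariant subgroup -/
def D8S.res {G : Type*} [Group G] (D : D8S G) (H : Subgroup G) (ha : ∀ x ∈ H, D.a x ∈ H)
    (hb : ∀ x ∈ H, D.b x ∈ H) (hs : ∀ x ∈ H, D.s x ∈ H) : D8S H where
  a := (D.a.comp H.subtype).codRestrict H (fun x => ha x x.2)
  b := (D.b.comp H.subtype).codRestrict H (fun x => hb x x.2)
  s := (D.s.comp H.subtype).codRestrict H (fun x => hs x x.2)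
  aa := fun x => Subtype.ext (D.aa x)
  bb := fun x => Subtype.ext (D.bb x)
  ss := fun x => Subtype.ext (D.ss x)
  ab := fun x => Subtype.ext (D.ab x)
  sa := fun x => Subtype.ext (D.sa x)
  fix := fun x h h' => Subtype.ext (D.fix x (congrArg Subtype.val h) (congrArg Subtype.val h'))

theorem odd_sub {G : Type*} [Group G] [Finite G] (ho : Odd (Nat.card G)) (H : Subgroup G) :
    Odd (Nat.card H) := ho.of_dvd_nat H.card_subgroup_dvd_card

/-- exponent bound in the p-group case -/
def FF (p k : ℕ) : ℕ := Fd p k 6 * Fd p k (2 * (2 * Fd p k 6))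

section
variable {G : Type*} [Group G] (D : D8S G) {p : ℕ} [Finite G] (ho : Odd (Nat.card G))
  (hp2 : Odd p)
  (hp : p.Prime) (hG : IsPGroup p G) (k : ℕ) (hq : ∀ c, D.s c = c → c ^ p ^ k = 1)
include ho hp2 hp hG hq

theorem closure_exp (T : Finset G) (hT : ∀ g ∈ T, D.a g = g ∨ D.b g = g) (d : ℕ)
    (hd : T.card ≤ d) (g : G) (hg : g ∈ Subgroup.closure (T : Set G)) :
    g ^ Fd p k (2 * d) = 1 := by
  classical
  set S := T ∪ T.image D.s with hS
  set H := Subgroup.closure (S : Set G) with hH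
  have hSf : ∀ g ∈ S, D.a g = g ∨ D.b g = g := by
    intro g hg
    rw [hS, Finset.mem_union, Finset.mem_image] at hg
    rcases hg with hg | ⟨t, ht, rfl⟩
    · exact hT g hg
    · rcases hT t ht with h | h
      · right; rw [← D.sa, h]
      · left; rw [← D.sb, h]
  have key : ∀ σ : G →* G, (∀ g ∈ S, σ g ∈ H) → ∀ x ∈ H, σ x ∈ H := by
    intro σ h x hx
    have : H ≤ H.comap σ := by
      conv_lhs => rw [hH]
      rw [Subgroup.closure_le]
      exact h
    exact this hx
  have mem : ∀ g ∈ S, g ∈ H := fun g h => Subgroup.subset_closure h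
  have ha : ∀ x ∈ H, D.a x ∈ H := key _ (fun g hg => by
    rcases hSf g hg with h | h
    · rw [h]; exact mem g hg
    · rw [D.a_b ho g h]; exact inv_mem (mem g hg))
  have hb : ∀ x ∈ H, D.b x ∈ H := key _ (fun g hg => by
    rcases hSf g hg with h | h
    · rw [D.b_a ho g h]; exact inv_mem (mem g hg)
    · rw [h]; exact mem g hg)
  have hs : ∀ x ∈ H, D.s x ∈ H := key _ (fun g hg => by
    apply mem
    rw [hS, Finset.mem_union, Finset.mem_image] at hg ⊢
    rcases hg with hg | ⟨t, ht, rfl⟩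
    · right; exact ⟨g, hg, rfl⟩
    · left; rw [D.ss]; exact ht)
  have hgH : g ∈ H := Subgroup.closure_mono (by simp [hS]) hg
  have := class_exp (D.res H ha hb hs) (odd_sub ho H) hp2 hp (hG.to_subgroup H) k
    (fun c hc => Subtype.ext (hq c (congrArg Subtype.val hc))) (S.subtype (· ∈ H))
    (fun x hx => by
      rcases hSf x (Finset.mem_subtype.1 hx) with h | h
      · left; exact Subtype.ext h
      · right; exact Subtype.ext h) (2 * d)
    (by
      rw [Finset.card_subtype]
      refine (Finset.card_filter_le _ _).trans ((Finset.card_union_le _ _).trans ?_)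
      have := Finset.card_image_le (s := T) (f := D.s)
      omega)
    (by
      have := Subgroup.closure_closure_coe_preimage (k := (S : Set G))
      convert this using 2
      ext x; simp [hH]) ⟨g, hgH⟩
  exact congrArg Subtype.val this

theorem L1 (x i : G) (hx : D.a x = x ∨ D.b x = x) (hi : D.z i = i⁻¹) :
    ∃ i' m, x * i = i' * m ∧ D.z i' = i'⁻¹ ∧ D.z m = m ∧ m ^ Fd p k 6 = 1 := by
  classical
  obtain ⟨x1, y1, hi1, hx1, hy1⟩ := D.Iz ho i hi
  obtain ⟨u, c, h1, h2, h3, h4⟩ := dec ho D.z D.zz (x * i)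
  refine ⟨u, c, h1, h2, h3, ?_⟩
  let T : Finset G := {x, x1, y1}
  have mx : x ∈ Subgroup.closure (T : Set G) := Subgroup.subset_closure (by simp [T])
  have mx1 : x1 ∈ Subgroup.closure (T : Set G) := Subgroup.subset_closure (by simp [T])
  have my1 : y1 ∈ Subgroup.closure (T : Set G) := Subgroup.subset_closure (by simp [T])
  have mi : i ∈ Subgroup.closure (T : Set G) := by
    rw [hi1]; exact mul_mem (mul_mem mx1 my1) mx1
  have zx : D.z x = x⁻¹ := by
    rcases hx with h | h
    · exact D.z_a ho x h
    · exact D.z_b ho x h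
  have mu : u ∈ Subgroup.closure (T : Set G) := by
    rw [h4]
    apply sq_mem
    rw [map_mul, zx, hi]
    exact mul_mem (mul_mem mx mi) (inv_mem (mul_mem (inv_mem mx) (inv_mem mi)))
  have mc : c ∈ Subgroup.closure (T : Set G) := by
    have : c = u⁻¹ * (x * i) := by rw [h1]; group
    rw [this]
    exact mul_mem (inv_mem mu) (mul_mem mx mi)
  refine closure_exp D ho hp2 hp hG k hq T ?_ 3 Finset.card_le_three c mc
  intro g hg
  simp only [T, Finset.mem_insert, Finset.mem_singleton] at hg
  rcases hg with rfl | rfl | rfl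
  · exact hx
  · exact Or.inl hx1
  · exact Or.inr hy1

omit ho hp2 hp hG hq [Finite G] k p in
variable (G) in
/-- the subgroup generated by all `x` fixed by `a` or by `b` -/
def _root_.D8P.D8S.K (D : D8S G) : Subgroup G := Subgroup.closure {x | D.a x = x ∨ D.b x = x}

theorem L2 (g : G) (hg : g ∈ D.K) :
    ∃ i m, g = i * m ∧ D.z i = i⁻¹ ∧ D.z m = m ∧ m ^ Fd p k 6 = 1 := by
  have step : ∀ x y, (D.a x = x ∨ D.b x = x) →
      (∃ i m, y = i * m ∧ D.z i = i⁻¹ ∧ D.z m = m ∧ m ^ Fd p k 6 = 1) →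
      (∃ i m, x * y = i * m ∧ D.z i = i⁻¹ ∧ D.z m = m ∧ m ^ Fd p k 6 = 1) := by
    rintro x y hx ⟨i, m, rfl, hi, hm, hm'⟩
    obtain ⟨i', m', h1, h2, h3, h4⟩ := L1 D ho hp2 hp hG k hq x i hx hi
    refine ⟨i', m' * m, ?_, h2, ?_, ?_⟩
    · rw [← mul_assoc, h1, mul_assoc]
    · rw [map_mul, h3, hm]
    · rw [(show Commute m' m from D.comm_z ho _ _ h3 hm).mul_pow, h4, hm', one_mul]
  unfold D8S.K at hg
  induction hg using Subgroup.closure_induction_left with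
  | one => exact ⟨1, 1, by simp, by simp, by simp, by simp⟩
  | mul_left x hx y hy ih => exact step x y hx ih
  | inv_mul_cancel x hx y hy ih =>
    refine step _ y ?_ ih
    rcases hx with h | h
    · left; rw [map_inv, h]
    · right; rw [map_inv, h]

omit hp2 hp hG hq k p in
theorem L3a (i m : G) (hi : D.z i = i⁻¹) (hm : D.z m = m) (n : ℕ) :
    ∃ T : Finset G, T.card ≤ 2 * n ∧ (∀ t ∈ T, D.a t = t ∨ D.b t = t) ∧
      ∃ h ∈ Subgroup.closure (T : Set G), (i * m) ^ n = h * m ^ n := by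
  classical
  induction n with
  | zero => exact ⟨∅, by simp, by simp, 1, one_mem _, by simp⟩
  | succ n ih =>
    obtain ⟨T, h1, h2, h, h3, h4⟩ := ih
    obtain ⟨x, y, h5, hx, hy⟩ := D.Iz ho (m ^ n * i * (m ^ n)⁻¹) (by
      rw [map_mul, map_mul, map_inv, map_pow, hm, hi]; group)
    refine ⟨insert x (insert y T), ?_, ?_, h * (m ^ n * i * (m ^ n)⁻¹), ?_, ?_⟩
    · have e1 := Finset.card_insert_le x (insert y T)
      have e2 := Finset.card_insert_le y T
      omega
    · intro t ht
      rw [Finset.mem_insert, Finset.mem_insert] at ht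
      rcases ht with rfl | rfl | ht
      · exact Or.inl hx
      · exact Or.inr hy
      · exact h2 t ht
    · have mx : x ∈ Subgroup.closure ((insert x (insert y T) : Finset G) : Set G) :=
        Subgroup.subset_closure (by simp)
      have my : y ∈ Subgroup.closure ((insert x (insert y T) : Finset G) : Set G) :=
        Subgroup.subset_closure (by simp)
      rw [h5]
      refine mul_mem (Subgroup.closure_mono ?_ h3) (mul_mem (mul_mem mx my) mx)
      intro t ht
      simp only [Finset.coe_insert, Set.mem_insert_iff]
      exact Or.inr (Or.inr ht)
    · rw [pow_succ, h4, pow_succ]; group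

theorem L3 (g : G) (hg : g ∈ D.K) : g ^ FF p k = 1 := by
  obtain ⟨i, m, rfl, hi, hm, hm'⟩ := L2 D ho hp2 hp hG k hq g hg
  obtain ⟨T, h1, h2, h, h3, h4⟩ := L3a D ho i m hi hm (Fd p k 6)
  rw [hm', mul_one] at h4
  rw [FF, pow_mul, h4]
  exact closure_exp D ho hp2 hp hG k hq T h2 _ h1 h h3

omit hp2 hp hG hq k p in
theorem Iz_K (i : G) (hi : D.z i = i⁻¹) : i ∈ D.K := by
  obtain ⟨x, y, rfl, hx, hy⟩ := D.Iz ho i hi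
  have mx : x ∈ D.K := Subgroup.subset_closure (Or.inl hx)
  have my : y ∈ D.K := Subgroup.subset_closure (Or.inr hy)
  exact mul_mem (mul_mem mx my) mx

omit hp2 hp hG hq k p in
theorem K_normal : D.K.Normal := by
  have hm : ∀ m, D.z m = m → ∀ x ∈ D.K, m * x * m⁻¹ ∈ D.K := by
    intro m hm x hx
    have : D.K ≤ D.K.comap (MulAut.conj m).toMonoidHom := by
      conv_lhs => rw [D8S.K]
      rw [Subgroup.closure_le]
      intro t ht
      show m * t * m⁻¹ ∈ D.K
      apply Iz_K D ho
      have zt : D.z t = t⁻¹ := by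
        rcases ht with h | h
        · exact D.z_a ho t h
        · exact D.z_b ho t h
      rw [map_mul, map_mul, map_inv, hm, zt]; group
    exact this hx
  refine ⟨fun n hn g => ?_⟩
  obtain ⟨x, y, m, rfl, hx, hy, hz⟩ := D.xym ho g
  have mx : x ∈ D.K := Subgroup.subset_closure (Or.inl hx)
  have my : y ∈ D.K := Subgroup.subset_closure (Or.inr hy)
  have e : x * y * m * n * (x * y * m)⁻¹ = (x * y) * (m * n * m⁻¹) * (x * y)⁻¹ := by group
  rw [e]
  exact mul_mem (mul_mem (mul_mem mx my) (hm m hz n hn)) (inv_mem (mul_mem mx my))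

omit hp2 hp hG hq k p in
theorem comm_le_K : commutator G ≤ D.K := by
  have := K_normal D ho
  rw [commutator_def, Subgroup.commutator_le]
  have fk : ∀ g, (QuotientGroup.mk' D.K) g = 1 ↔ g ∈ D.K := fun g => QuotientGroup.eq_one_iff g
  have key : ∀ g, ∃ m, D.z m = m ∧ (QuotientGroup.mk' D.K) g = (QuotientGroup.mk' D.K) m := by
    intro g
    obtain ⟨x, y, m, rfl, hx, hy, hz⟩ := D.xym ho g
    have mx : x ∈ D.K := Subgroup.subset_closure (Or.inl hx)
    have my : y ∈ D.K := Subgroup.subset_closure (Or.inr hy)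
    refine ⟨m, hz, ?_⟩
    rw [map_mul, (fk _).2 (mul_mem mx my), one_mul]
  intro g _ h _
  obtain ⟨m, hm, e⟩ := key g
  obtain ⟨m', hm', e'⟩ := key h
  rw [← fk, map_commutatorElement, e, e', ← map_commutatorElement,
    commutatorElement_eq_one_iff_mul_comm.2 (D.comm_z ho _ _ hm hm'), map_one]

theorem comm_exp (g : G) (hg : g ∈ commutator G) : g ^ FF p k = 1 :=
  L3 D ho hp2 hp hG k hq g (comm_le_K D ho hg)

theorem I_exp (i : G) (hi : D.z i = i⁻¹) : i ^ FF p k = 1 :=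
  L3 D ho hp2 hp hG k hq i (Iz_K D ho i hi)
end

end D8P


namespace D8P
open scoped commutatorElement

theorem ord_lt {G : Type*} [Group G] [Finite G] {p : ℕ} (hp : p.Prime) {x : G} {n r : ℕ}
    (hx : x ^ p ^ n = 1) (h1 : x ≠ 1) (hr : p ∣ r) : orderOf (x ^ r) < orderOf x := by
  obtain ⟨j, hj, e⟩ := (Nat.dvd_prime_pow hp).1 (orderOf_dvd_of_pow_eq_one hx)
  have j0 : j ≠ 0 := by
    rintro rfl
    rw [pow_zero, orderOf_eq_one_iff] at e
    exact h1 e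
  obtain ⟨i, rfl⟩ := Nat.exists_eq_succ_of_ne_zero j0
  obtain ⟨t, rfl⟩ := hr
  have : (x ^ (p * t)) ^ p ^ i = 1 := by
    rw [← pow_mul, show p * t * p ^ i = p ^ (i + 1) * t by ring, pow_mul]
    rw [show p ^ (i + 1) = orderOf x from e.symm, pow_orderOf_eq_one, one_pow]
  rw [e]
  exact (Nat.le_of_dvd (pow_pos hp.pos _) (orderOf_dvd_of_pow_eq_one this)).trans_lt
    (Nat.pow_lt_pow_right hp.one_lt (Nat.lt_succ_self i))

open Classical in
/-- extension by one -/
noncomputable def ext1 {G : Type*} [Group G] {P : Subgroup G} {A : Type*} [CommGroup A]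
    (θ : P →* A) (g : G) : A := if h : g ∈ P then θ ⟨g, h⟩ else 1

theorem ext1_of {G : Type*} [Group G] {P : Subgroup G} {A : Type*} [CommGroup A]
    (θ : P →* A) (g : G) (h : g ∈ P) : ext1 θ g = θ ⟨g, h⟩ := dif_pos h

theorem card_fiber {G : Type*} [Group G] [Finite G] {p : ℕ} (hp : p.Prime) (P : Subgroup G)
    (hP : IsPGroup p P) (x : G) (hx : x ∈ P) (c0 : G ⧸ P) (hc : ¬ ∀ u ∈ P, u • c0 = c0) :
    p ∣ Nat.card {c : G ⧸ P // c ∈ MulAction.orbit P c0 ∧ x • c = c} := by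
  have : Fact p.Prime := ⟨hp⟩
  let Z := Subgroup.zpowers (⟨x, hx⟩ : P)
  have h1 := (hP.to_subgroup Z).card_modEq_card_fixedPoints (MulAction.orbit P c0)
  obtain ⟨n, hn⟩ := hP.card_orbit c0
  have hn0 : n ≠ 0 := by
    rintro rfl
    rw [pow_zero, Nat.card_eq_one_iff_unique] at hn
    apply hc
    intro u hu
    have := hn.1.elim ⟨(⟨u, hu⟩ : P) • c0, MulAction.mem_orbit _ _⟩ ⟨c0, MulAction.mem_orbit_self _⟩
    exact congrArg Subtype.val this
  have h2 : p ∣ Nat.card (MulAction.fixedPoints Z (MulAction.orbit P c0)) := by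
    rw [← h1.dvd_iff dvd_rfl, hn]
    exact dvd_pow_self p hn0
  convert h2 using 1
  apply Nat.card_congr
  refine ⟨fun c => ⟨⟨c.1, c.2.1⟩, ?_⟩, fun c => ⟨c.1.1, c.1.2, ?_⟩, fun c => rfl, fun c => rfl⟩
  · rintro ⟨w, hw⟩
    apply Subtype.ext
    have hs : w ∈ MulAction.stabilizer P c.1 := by
      have : Z ≤ MulAction.stabilizer P c.1 := by
        rw [Subgroup.zpowers_le]
        exact c.2.2
      exact this hw
    exact hs
  · exact congrArg Subtype.val (c.2 ⟨⟨x, hx⟩, Subgroup.mem_zpowers _⟩)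

section
variable {G : Type*} [Group G] [Finite G] {p : ℕ} (hp : p.Prime) (P : Subgroup G)
    (hP : IsPGroup p P) (hi : ¬ p ∣ P.index) {A : Type*} [CommGroup A] (θ : P →* A)
    (hN : ∀ n : G, (∀ u ∈ P, n⁻¹ * u * n ∈ P) → ∀ x ∈ P, ext1 θ (n⁻¹ * x * n) = ext1 θ x)
    (hF : ∀ u ∈ P, (∃ g, ∃ v ∈ commutator P, g * u * g⁻¹ = (v : G)) → ext1 θ u = 1)
include hp hP hi hN hF

omit hp hi hN hF p hP [Finite G] in
theorem ext1_mul (x y : G) (hx : x ∈ P) (hy : y ∈ P) :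
    ext1 θ (x * y) = ext1 θ x * ext1 θ y := by
  rw [ext1_of θ x hx, ext1_of θ y hy, ext1_of θ _ (mul_mem hx hy), ← map_mul]; rfl

omit hp hi hN hF p hP [Finite G] in
theorem ext1_pow (x : G) (hx : x ∈ P) (n : ℕ) :
    ext1 θ (x ^ n) = ext1 θ x ^ n := by
  rw [ext1_of θ x hx, ext1_of θ _ (pow_mem hx n), ← map_pow]; rfl

omit hp hi hN hF p hP [Finite G] in
theorem fix_iff (x : G) (c : G ⧸ P) : x • c = c ↔ c.out⁻¹ * x * c.out ∈ P := by
  conv_lhs => rw [← QuotientGroup.out_eq' c]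
  rw [eq_comm, MulAction.Quotient.smul_mk, QuotientGroup.eq, smul_eq_mul, mul_assoc]

theorem gruen_aux (n : ℕ) : ∀ x : G, orderOf x = n → x ∈ P → x ∈ commutator G → ext1 θ x = 1 := by
  classical
  induction n using Nat.strong_induction_on with
  | _ n ih =>
  intro x hxn hxP hxG
  by_cases hx1 : x = 1
  · rw [hx1, ext1_of θ 1 (one_mem P)]; exact map_one θ
  have : Fintype (G ⧸ P) := Fintype.ofFinite _
  obtain ⟨j, hj⟩ := hP ⟨x, hxP⟩
  have hj : x ^ p ^ j = 1 := congrArg Subtype.val hj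
  have IH : ∀ (r : ℕ) (g : G), p ∣ r → g⁻¹ * x ^ r * g ∈ P → ext1 θ (g⁻¹ * x ^ r * g) = 1 := by
    intro r g hr hg
    refine ih _ ?_ _ rfl hg ?_
    · rw [← hxn]
      have : orderOf (g⁻¹ * x ^ r * g) = orderOf (x ^ r) := by
        have := orderOf_injective (MulAut.conj g⁻¹).toMonoidHom (MulAut.conj g⁻¹).injective (x ^ r)
        simpa using this
      rw [this]
      exact ord_lt hp hj hx1 hr
    · have := (inferInstance : (commutator G).Normal).conj_mem _ (pow_mem hxG r) g⁻¹
      rwa [inv_inv] at this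
  let val : G ⧸ P → A := fun c => if x • c = c then ext1 θ (c.out⁻¹ * x * c.out) else 1
  -- transfer
  have hT : MonoidHom.transfer θ x = 1 := by
    have : commutator G ≤ (MonoidHom.transfer θ).ker := Abelianization.commutator_subset_ker _
    exact this hxG
  let mkZ : G ⧸ P → Quotient (MulAction.orbitRel (Subgroup.zpowers x) (G ⧸ P)) :=
    fun c => Quotient.mk'' c
  have hprod : ∏ c, val c = 1 := by
    rw [← hT, MonoidHom.transfer_eq_prod_quotient_orbitRel_zpowers_quot,
      ← Finset.prod_fiberwise Finset.univ mkZ val]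
    refine Finset.prod_congr rfl fun q _ => ?_
    rw [Finset.prod_eq_single q.out]
    · have hmem := QuotientGroup.out_conj_pow_minimalPeriod_mem P x q.out
      rw [← ext1_of θ _ hmem]
      by_cases hf : x • q.out = q.out
      · have : Function.minimalPeriod (x • ·) q.out = 1 :=
          Function.minimalPeriod_eq_one_iff_isFixedPt.2 hf
        rw [this, pow_one]
        exact if_pos hf
      · have h1 : Function.minimalPeriod (x • ·) q.out ≠ 1 := fun h =>
          hf (Function.minimalPeriod_eq_one_iff_isFixedPt.1 h)
        have h2 : Function.minimalPeriod (x • ·) q.out ∣ p ^ j := by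
          apply Function.IsPeriodicPt.minimalPeriod_dvd
          show (x • ·)^[p ^ j] q.out = q.out
          rw [smul_iterate, hj]
          exact one_smul G _
        have h3 : p ∣ Function.minimalPeriod (x • ·) q.out := by
          obtain ⟨i, -, e⟩ := (Nat.dvd_prime_pow hp).1 h2
          rw [e] at h1 ⊢
          exact dvd_pow_self p (by rintro rfl; exact h1 (pow_zero p))
        rw [IH _ _ h3 hmem]
        exact if_neg hf
    · intro c hc hne
      apply if_neg
      intro hf
      apply hne
      have hc' : mkZ c = q := (Finset.mem_filter.1 hc).2
      have h2 : (Quotient.mk'' q.out : Quotient (MulAction.orbitRel (Subgroup.zpowers x) (G ⧸ P)))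
        = Quotient.mk'' c := by rw [Quotient.out_eq' q]; exact hc'.symm
      have h3 : q.out ∈ MulAction.orbit (Subgroup.zpowers x) c :=
        MulAction.orbitRel_apply.1 (Quotient.eq''.1 h2)
      obtain ⟨⟨w, hw⟩, e⟩ := h3
      have hs : w ∈ MulAction.stabilizer G c := by
        have : Subgroup.zpowers x ≤ MulAction.stabilizer G c := by
          rw [Subgroup.zpowers_le]
          exact hf
        exact this hw
      rw [← e]
      exact hs.symm
    · intro h
      exact absurd (Finset.mem_filter.2 ⟨Finset.mem_univ q.out, (Quotient.out_eq' q : mkZ q.out = q)⟩) h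
  let FP : G ⧸ P → Prop := fun c => ∀ u ∈ P, u • c = c
  rw [← Finset.prod_filter_mul_prod_filter_not Finset.univ FP] at hprod
  have hfix : ∏ c with FP c, val c = ext1 θ x ^ (Finset.univ.filter FP).card := by
    rw [Finset.prod_eq_pow_card]
    intro c hc
    have hc : FP c := (Finset.mem_filter.1 hc).2
    rw [show val c = _ from if_pos (hc x hxP)]
    exact hN _ (fun u hu => (fix_iff P u c).1 (hc u hu)) x hxP
  let mkP : G ⧸ P → Quotient (MulAction.orbitRel P (G ⧸ P)) := fun c => Quotient.mk'' c
  have mkP_iff : ∀ c c0, mkP c = mkP c0 ↔ c ∈ MulAction.orbit P c0 := fun c c0 =>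
    Quotient.eq''.trans MulAction.orbitRel_apply
  have hnf : ∏ c with ¬ FP c, val c = 1 := by
    rw [← Finset.prod_fiberwise _ mkP val]
    apply Finset.prod_eq_one
    intro ω _
    by_cases hex : ∃ c0, mkP c0 = ω ∧ ¬ FP c0 ∧ x • c0 = c0
    · obtain ⟨c0, rfl, hc0, hf⟩ := hex
      have hval : ∀ c, mkP c = mkP c0 → x • c = c →
          ext1 θ (c.out⁻¹ * x * c.out) = ext1 θ (c0.out⁻¹ * x * c0.out) := by
        intro c hc hxc
        have m0 := (fix_iff P x c0).1 hf
        have m1 := (fix_iff P x c).1 hxc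
        obtain ⟨⟨u, hu⟩, e⟩ := (mkP_iff c c0).1 hc
        have e : u • c0 = c := e
        -- c.out = u * c0.out * w
        obtain ⟨w, hw⟩ : ∃ w : P, c.out = u * c0.out * w := by
          have : (QuotientGroup.mk (u * c0.out) : G ⧸ P) = QuotientGroup.mk c.out := by
            rw [QuotientGroup.out_eq', ← e]
            have h := congrArg (u • ·) (QuotientGroup.out_eq' c0)
            exact h
          rw [QuotientGroup.eq] at this
          exact ⟨⟨_, this⟩, by simp only []; group⟩
        set g := c0.out with hg
        have m2 : g⁻¹ * (u⁻¹ * x * u) * g ∈ P := by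
          have := mul_mem (mul_mem w.2 m1) (inv_mem w.2)
          rw [hw] at this
          convert this using 1
          group
        have e1 : ext1 θ (c.out⁻¹ * x * c.out) = ext1 θ (g⁻¹ * (u⁻¹ * x * u) * g) := by
          have : c.out⁻¹ * x * c.out = (w : G)⁻¹ * (g⁻¹ * (u⁻¹ * x * u) * g) * w := by
            rw [hw]; group
          rw [this]
          exact hN w (fun u hu => mul_mem (mul_mem (inv_mem w.2) hu) w.2) _ m2
        rw [e1]
        have e2 : g⁻¹ * (u⁻¹ * x * u) * g =
            (g⁻¹ * x * g) * (g⁻¹ * (x⁻¹ * u⁻¹ * x * u) * g) := by group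
        have m3 : g⁻¹ * (x⁻¹ * u⁻¹ * x * u) * g ∈ P := by
          have := mul_mem (inv_mem m0) m2
          rw [e2] at this
          convert this using 1
          group
        rw [e2, ext1_mul P θ _ _ m0 m3, hF _ m3, mul_one]
        refine ⟨g, ⁅(⟨x, hxP⟩ : P)⁻¹, (⟨u, hu⟩ : P)⁻¹⁆,
          Subgroup.commutator_mem_commutator (Subgroup.mem_top _) (Subgroup.mem_top _), ?_⟩
        rw [commutatorElement_def]
        simp only [inv_inv, Subgroup.coe_mul, Subgroup.coe_inv]
        group
      set y := ext1 θ (c0.out⁻¹ * x * c0.out) with hy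
      have hyp : y ^ p = 1 := by
        have m0 := (fix_iff P x c0).1 hf
        rw [hy, ← ext1_pow P θ _ m0]
        have e : (c0.out⁻¹ * x * c0.out) ^ p = c0.out⁻¹ * x ^ p * c0.out := by
          have := conj_pow (a := c0.out⁻¹) (b := x) (i := p)
          rwa [inv_inv] at this
        have m1 := pow_mem m0 p
        rw [e] at m1 ⊢
        exact IH p _ dvd_rfl m1
      have hnFP : ∀ c, mkP c = mkP c0 → ¬ FP c := by
        intro c hc hfp
        apply hc0
        have : c0 ∈ MulAction.orbit P c := (mkP_iff c0 c).1 hc.symm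
        obtain ⟨⟨u, hu⟩, e⟩ := this
        have e : u • c = c0 := e
        rw [hfp u hu] at e
        rw [← e]; exact hfp
      have e : ∏ c ∈ (Finset.univ.filter (fun c => ¬ FP c)) with mkP c = mkP c0, val c =
          ∏ c with (c ∈ MulAction.orbit P c0 ∧ x • c = c), y := by
        have : (Finset.univ.filter (fun c => ¬ FP c)).filter (fun c => mkP c = mkP c0) =
            Finset.univ.filter (fun c => c ∈ MulAction.orbit P c0) := by
          ext c
          simp only [Finset.mem_filter, Finset.mem_univ, true_and, mkP_iff]
          exact ⟨fun h => h.2, fun h => ⟨hnFP c ((mkP_iff c c0).2 h), h⟩⟩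
        rw [this, ← Finset.filter_filter, Finset.prod_filter (fun c => x • c = c)]
        refine Finset.prod_congr rfl fun c hc => ?_
        by_cases h : x • c = c
        · rw [show val c = _ from if_pos h, if_pos h]
          exact hval c ((mkP_iff c c0).2 (Finset.mem_filter.1 hc).2) h
        · rw [show val c = _ from if_neg h, if_neg h]
      rw [e, Finset.prod_const]
      have hd := card_fiber hp P hP x hxP c0 hc0
      rw [Nat.card_eq_fintype_card, Fintype.card_subtype] at hd
      obtain ⟨t, ht⟩ := hd
      rw [ht, pow_mul, hyp, one_pow]
    · apply Finset.prod_eq_one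
      intro c hc
      rw [Finset.mem_filter, Finset.mem_filter] at hc
      exact if_neg fun h => hex ⟨c, hc.2, hc.1.2, h⟩
  rw [hfix, hnf, mul_one] at hprod
  have hpj : ext1 θ x ^ p ^ j = 1 := by
    rw [← ext1_pow P θ x hxP, hj, ext1_of θ 1 (one_mem P)]; exact map_one θ
  have hcop : Nat.Coprime (Finset.univ.filter FP).card (p ^ j) := by
    apply Nat.Coprime.pow_right
    rw [Nat.coprime_comm, Nat.Prime.coprime_iff_not_dvd hp]
    intro hd
    apply hi
    have : Fact p.Prime := ⟨hp⟩
    have h1 := hP.card_modEq_card_fixedPoints (G ⧸ P)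
    rw [Subgroup.index, h1.dvd_iff dvd_rfl]
    convert hd using 1
    rw [← Fintype.card_subtype, ← Nat.card_eq_fintype_card]
    apply Nat.card_congr
    exact Equiv.subtypeEquivRight fun c => ⟨fun h u hu => h ⟨u, hu⟩, fun h u => h u.1 u.2⟩
  have := (orderOf_dvd_of_pow_eq_one hprod)
  have h2 := (orderOf_dvd_of_pow_eq_one hpj)
  exact orderOf_eq_one_iff.1 (Nat.eq_one_of_dvd_coprimes hcop this h2)

theorem gruen (x : G) (hx : x ∈ P) (hx' : x ∈ commutator G) : ext1 θ x = 1 :=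
  gruen_aux hp P hP hi θ hN hF _ x rfl hx hx'
end

end D8P


namespace D8P

section
variable {G : Type*} [Group G] (D : D8S G) {p : ℕ} [Finite G] (ho : Odd (Nat.card G))
  (hp2 : Odd p) (hp : p.Prime) (P : Subgroup G)
  (hP : IsPGroup p P) (hi : ¬ p ∣ P.index)
  (ha : ∀ x ∈ P, D.a x ∈ P) (hb : ∀ x ∈ P, D.b x ∈ P) (hs : ∀ x ∈ P, D.s x ∈ P)
  (k : ℕ) (hq : ∀ c ∈ P, D.s c = c → c ^ p ^ k = 1)
include ho hp2 hp hP hi ha hb hs hq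

theorem sylow_exp (x : G) (hx : x ∈ P) (hx' : x ∈ commutator G) : x ^ (FF p k * FF p k) = 1 := by
  set F := FF p k with hF
  let DP := D.res P ha hb hs
  have hoP := odd_sub ho P
  have hqP : ∀ c, DP.s c = c → c ^ p ^ k = 1 := fun c hc =>
    Subtype.ext (hq c c.2 (congrArg Subtype.val hc))
  have hz : ∀ x ∈ P, D.z x ∈ P := fun x hx => ha _ (hb x hx)
  have hcF : ∀ v ∈ commutator P, v ^ F = 1 := comm_exp DP hoP hp2 hp hP k hqP
  have hiF : ∀ i ∈ P, D.z i = i⁻¹ → i ^ F = 1 := fun i hi hzi =>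
    congrArg Subtype.val (I_exp DP hoP hp2 hp hP k hqP ⟨i, hi⟩ (Subtype.ext hzi))
  have hdec : ∀ x ∈ P, ∃ i ∈ P, ∃ m ∈ P, x = i * m ∧ D.z i = i⁻¹ ∧ D.z m = m := by
    intro x hx
    obtain ⟨u, c, h1, h2, h3, h4⟩ := dec ho D.z D.zz x
    have mu : u ∈ P := by
      rw [h4]; exact sq_mem (mul_mem hx (inv_mem (hz x hx)))
    refine ⟨u, mu, c, ?_, h1, h2, h3⟩
    have : c = u⁻¹ * x := by rw [h1]; group
    rw [this]; exact mul_mem (inv_mem mu) hx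
  let θ : P →* Abelianization P := (powMonoidHom F).comp Abelianization.of
  have t1 : ∀ u ∈ P, u ^ F = 1 → ext1 θ u = 1 := by
    intro u hu h
    rw [ext1_of θ u hu]
    show (Abelianization.of (⟨u, hu⟩ : P)) ^ F = 1
    rw [← map_pow, show (⟨u, hu⟩ : P) ^ F = 1 from Subtype.ext h, map_one]
  let H : Submonoid G :=
    { carrier := {n | ∀ u ∈ P, n⁻¹ * u * n ∈ P}
      one_mem' := by intro u hu; simpa using hu
      mul_mem' := by
        intro m n hm hn u hu
        have := hn _ (hm u hu)
        rwa [show (m * n)⁻¹ * u * (m * n) = n⁻¹ * (m⁻¹ * u * m) * n by group] }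
  have hmem : ∀ n, n ∈ H → ∀ u ∈ P, n⁻¹ * u * n ∈ P := fun n hn => hn
  have Hinv : ∀ n ∈ H, n⁻¹ ∈ H := by
    intro n hn
    have : n⁻¹ = n ^ (orderOf n - 1) := by
      apply inv_eq_of_mul_eq_one_right
      rw [mul_pow_sub_one (orderOf_pos n).ne', pow_orderOf_eq_one]
    rw [this]; exact pow_mem hn _
  have Hz : ∀ n ∈ H, D.z n ∈ H := by
    intro n hn u hu
    have := hz _ (hn _ (hz u hu))
    rwa [map_mul, map_mul, map_inv, D.zz] at this
  have conjF : ∀ n i : G, i ^ F = 1 → (n⁻¹ * i * n) ^ F = 1 := by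
    intro n i h
    have := conj_pow (a := n⁻¹) (b := i) (i := F)
    rw [inv_inv, h] at this
    rw [this]; group
  have zinv : ∀ x ∈ P, ext1 θ (D.z x) = ext1 θ x := by
    intro x hx
    obtain ⟨i, hi, m, hm, rfl, h1, h2⟩ := hdec x hx
    rw [map_mul, h1, h2, ext1_mul P θ _ _ (inv_mem hi) hm, ext1_mul P θ _ _ hi hm,
      t1 i hi (hiF i hi h1), t1 _ (inv_mem hi) (by rw [inv_pow, hiF i hi h1, inv_one])]
  have cst : ∀ c ∈ H, D.z c = c → ∀ x ∈ P, ext1 θ (c⁻¹ * x * c) = ext1 θ x := by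
    intro c hc hzc x hx
    obtain ⟨i, hi, m, hm, rfl, h1, h2⟩ := hdec x hx
    have e : c⁻¹ * (i * m) * c = (c⁻¹ * i * c) * m := by
      rw [show c⁻¹ * (i * m) * c = c⁻¹ * i * (m * c) by group, D.comm_z ho m c h2 hzc]; group
    rw [e, ext1_mul P θ _ _ (hc i hi) hm, ext1_mul P θ _ _ hi hm,
      t1 i hi (hiF i hi h1), t1 _ (hc i hi) (conjF c i (hiF i hi h1))]
  have rst : ∀ r ∈ H, D.z r = r⁻¹ → ∀ x ∈ P, ext1 θ (r⁻¹ * x * r) = ext1 θ x := by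
    intro r hr hzr y hy
    set w := sq r with hw
    have hwr : w * w = r := sq_mul_self ho r
    have hzw : D.z w = w⁻¹ := by rw [hw, sq_map, hzr, sq_inv]
    have hwH : w ∈ H := pow_mem hr _
    have hwH' := Hinv w hwH
    have hx := hwH y hy
    obtain ⟨i, hi, m, hm, e, h1, h2⟩ := hdec _ hx
    have e1 : r⁻¹ * y * r = w⁻¹ * (i * m) * w := by rw [← e, ← hwr]; group
    have e2 : y = w⁻¹⁻¹ * (i * m) * w⁻¹ := by rw [← e]; group
    have hxm : i * m ∈ P := mul_mem hi hm
    have e3 : D.z (w⁻¹ * (i * m) * w) = w⁻¹⁻¹ * (i⁻¹ * m) * w⁻¹ := by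
      rw [map_mul, map_mul, map_mul, map_inv, hzw, h1, h2]
    have sp : ∀ i' : G, w⁻¹⁻¹ * (i' * m) * w⁻¹ = (w⁻¹⁻¹ * i' * w⁻¹) * (w⁻¹⁻¹ * m * w⁻¹) := by
      intro i'; group
    rw [e1, ← zinv _ (hwH _ hxm), e3]
    conv_rhs => rw [e2]
    rw [sp, sp, ext1_mul P θ _ _ (hwH' _ (inv_mem hi)) (hwH' _ hm),
      ext1_mul P θ _ _ (hwH' _ hi) (hwH' _ hm), t1 _ (hwH' _ hi) (conjF _ i (hiF i hi h1)),
      t1 _ (hwH' _ (inv_mem hi)) (conjF _ _ (by rw [inv_pow, hiF i hi h1, inv_one]))]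
  have main := gruen hp P hP hi θ (by
      intro n hn x hx
      have hn : n ∈ H := hn
      obtain ⟨r, c, h1, h2, h3, h4⟩ := dec ho D.z D.zz n
      have hr : r ∈ H := by
        rw [h4]; exact pow_mem (mul_mem hn (Hinv _ (Hz n hn))) _
      have hc : c ∈ H := by
        have : c = r⁻¹ * n := by rw [h1]; group
        rw [this]; exact mul_mem (Hinv r hr) hn
      rw [h1, show (r * c)⁻¹ * x * (r * c) = c⁻¹ * (r⁻¹ * x * r) * c by group,
        cst c hc h3 _ (hr x hx), rst r hr h2 x hx])
    (by
      rintro u hu ⟨g, v, hv, e⟩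
      apply t1 u hu
      have h1 : ((v : G)) ^ F = 1 := congrArg Subtype.val (hcF v hv)
      have h2 : u = g⁻¹ * v * g := by rw [← e]; group
      rw [h2]; exact conjF g _ h1) x hx hx'
  rw [ext1_of θ x hx] at main
  have main : (Abelianization.of (⟨x, hx⟩ : P)) ^ F = 1 := main
  rw [← map_pow, ← MonoidHom.mem_ker, Abelianization.ker_of] at main
  have := hcF _ main
  rw [← pow_mul] at this
  exact congrArg Subtype.val this

end

theorem odd_of_fix {V G : Type*} [Group V] [Group G] [Finite G] [Finite V] (hV : IsPGroup 2 V)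
    (φ : V →* MulAut G) (h : ∀ x : G, (∀ v, φ v x = x) → x = 1) : Odd (Nat.card G) := by
  let _ : MulAction V G := MulAction.compHom G φ
  have : Fact (Nat.Prime 2) := ⟨Nat.prime_two⟩
  have h1 := hV.card_modEq_card_fixedPoints G
  have h2 : Nat.card (MulAction.fixedPoints V G) = 1 := by
    rw [Nat.card_eq_one_iff_unique]
    refine ⟨⟨fun x y => Subtype.ext ?_⟩, ⟨⟨1, fun v => map_one (φ v)⟩⟩⟩
    rw [h x.1 (fun v => x.2 v), h y.1 (fun v => y.2 v)]
  rw [h2] at h1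
  exact Nat.odd_iff.2 h1

theorem inv_sylow {A G : Type*} [Group A] [Group G] [Finite G] [Finite A] (hA : IsPGroup 2 A)
    (φ : A →* MulAut G) (ho : Odd (Nat.card G)) (p : ℕ) (hp : p.Prime) :
    ∃ P : Sylow p G, ∀ a : A, ∀ x ∈ P, φ a x ∈ P := by
  let _ : MulDistribMulAction A G := MulDistribMulAction.compHom G φ
  have : Fact (Nat.Prime 2) := ⟨Nat.prime_two⟩
  have : Fact p.Prime := ⟨hp⟩
  have h1 := hA.card_modEq_card_fixedPoints (Sylow p G)
  have h2 : Odd (Nat.card (Sylow p G)) :=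
    ho.of_dvd_nat ((Sylow.card_dvd_index (default : Sylow p G)).trans
      (Subgroup.index_dvd_card _))
  have h3 : Nat.card (MulAction.fixedPoints A (Sylow p G)) ≠ 0 := by
    intro h0
    rw [h0] at h1
    have := Nat.odd_iff.1 h2
    rw [Nat.ModEq] at h1
    omega
  obtain ⟨⟨P, hP⟩⟩ := (Nat.card_ne_zero.1 h3).1
  refine ⟨P, fun a x hx => ?_⟩
  have := hP a
  rw [← this]
  exact Subgroup.smul_mem_pointwise_smul x a P.toSubgroup hx

end D8P

namespace D8P

theorem exists_noncomm {A : Type*} [Group A] (i : A ≃* DihedralGroup 4) (V : Subgroup A)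
    (hV : V.index = 2) (hsq : ∀ v ∈ V, v * v = 1) (α : A) (hα : α * α = 1) (hαV : α ∉ V) :
    ∃ a ∈ V, α * a * α ≠ a := by
  by_contra hcon
  push Not at hcon
  have hVc : ∀ v ∈ V, ∀ w ∈ V, v * w = w * v := by
    intro v hv w hw
    have h1 := hsq _ (V.mul_mem hv hw)
    have h2 : v⁻¹ = v := inv_eq_of_mul_eq_one_left (hsq v hv)
    have h3 : w⁻¹ = w := inv_eq_of_mul_eq_one_left (hsq w hw)
    have h4 : (v * w)⁻¹ = v * w := inv_eq_of_mul_eq_one_left h1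
    rw [← h4, mul_inv_rev, h2, h3]
  have hαc : ∀ v ∈ V, α * v = v * α := by
    intro v hv
    have := hcon v hv
    calc α * v = α * v * (α * α) := by rw [hα, mul_one]
      _ = (α * v * α) * α := by group
      _ = v * α := by rw [this]
  have hform : ∀ x : A, ∃ v ∈ V, x = v ∨ x = v * α := by
    intro x
    by_cases hx : x ∈ V
    · exact ⟨x, hx, Or.inl rfl⟩
    · refine ⟨x * α, ?_, Or.inr (by rw [mul_assoc, hα, mul_one])⟩
      rw [Subgroup.mul_mem_iff_of_index_two hV]
      tauto
  have hcomm : ∀ x y : A, x * y = y * x := by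
    intro x y
    obtain ⟨v, hv, hx⟩ := hform x
    obtain ⟨w, hw, hy⟩ := hform y
    have c1 : Commute v w := hVc v hv w hw
    have c2 : Commute α v := hαc v hv
    have c3 : Commute α w := hαc w hw
    have c4 : Commute α α := Commute.refl α
    show Commute x y
    rcases hx with rfl | rfl <;> rcases hy with rfl | rfl
    · exact c1
    · exact c1.mul_right c2.symm
    · exact c1.mul_left c3
    · exact (c1.mul_right c2.symm).mul_left (c3.mul_right c4)
  have := hcomm (i.symm (DihedralGroup.r 1)) (i.symm (DihedralGroup.sr 0))
  rw [← map_mul, ← map_mul] at this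
  have h2 := i.symm.injective this
  revert h2
  decide

theorem exists_D8S {A G : Type*} [Group A] [Finite A] [Group G] (i : A ≃* DihedralGroup 4)
    (V : Subgroup A) (hV : V.index = 2) (hV4 : Nat.card V = 4)
    (hsq : ∀ v ∈ V, v * v = 1) (α : A) (hα : α * α = 1) (hαV : α ∉ V) (φ : A →* MulAut G)
    (hfix : ∀ x : G, (∀ v ∈ V, φ v x = x) → x = 1) :
    ∃ (D : D8S G) (a b : A), (∀ x, D.a x = φ a x) ∧ (∀ x, D.b x = φ b x) ∧
      (∀ x, D.s x = φ α x) := by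
  obtain ⟨a, ha, hne⟩ := exists_noncomm i V hV hsq α hα hαV
  have hN : V.Normal := Subgroup.normal_of_index_eq_two hV
  have hαi : α⁻¹ = α := inv_eq_of_mul_eq_one_left hα
  have hb : α * a * α ∈ V := by
    have := hN.conj_mem a ha α
    rwa [hαi] at this
  have hc : a * (α * a * α) = (α * a * α) * a := by
    have h1 := hsq _ (V.mul_mem ha hb)
    have h2 : a⁻¹ = a := inv_eq_of_mul_eq_one_left (hsq a ha)
    have h3 : (α * a * α)⁻¹ = α * a * α := inv_eq_of_mul_eq_one_left (hsq _ hb)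
    have h4 := inv_eq_of_mul_eq_one_left h1
    rw [mul_inv_rev, h2, h3] at h4
    exact h4.symm
  have hsb : α * a = (α * a * α) * α := by rw [mul_assoc _ α α, hα, mul_one]
  have happ : ∀ (u v : A) (x : G), φ u (φ v x) = φ (u * v) x := by
    intro u v x; rw [map_mul]; rfl
  have h1x : ∀ x : G, φ 1 x = x := by intro x; rw [map_one]; rfl
  refine ⟨⟨(φ a).toMonoidHom, (φ (α * a * α)).toMonoidHom, (φ α).toMonoidHom, ?_, ?_, ?_, ?_, ?_,
    ?_⟩, a, α * a * α, fun _ => rfl, fun _ => rfl, fun _ => rfl⟩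
  · intro x; show φ a (φ a x) = x; rw [happ, hsq a ha, h1x]
  · intro x
    show φ (α * a * α) (φ (α * a * α) x) = x
    rw [happ, hsq _ hb, h1x]
  · intro x; show φ α (φ α x) = x; rw [happ, hα, h1x]
  · intro x
    show φ a (φ (α * a * α) x) = φ (α * a * α) (φ a x)
    rw [happ, happ, hc]
  · intro x
    show φ α (φ a x) = φ (α * a * α) (φ α x)
    rw [happ, happ, ← hsb]
  · intro x hx hx2
    have hx : φ a x = x := hx
    have hx2 : φ (α * a * α) x = x := hx2
    let S : Subgroup A :=
      { carrier := {v | φ v x = x}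
        mul_mem' := by
          intro u v hu hv
          show φ (u * v) x = x
          rw [← happ, show φ v x = x from hv, show φ u x = x from hu]
        one_mem' := h1x x
        inv_mem' := by
          intro u hu
          have hu : φ u x = x := hu
          show φ u⁻¹ x = x
          conv_lhs => rw [← hu]
          rw [happ, inv_mul_cancel, h1x] }
    have hle : S ⊓ V ≤ V := inf_le_right
    have hdvd : Nat.card (S ⊓ V : Subgroup A) ∣ 4 := hV4 ▸ Subgroup.card_dvd_of_le hle
    have hane : a ≠ 1 := by
      rintro rfl
      apply hne
      rw [mul_one, hα]
    have hbne : α * a * α ≠ 1 := by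
      intro h
      apply hane
      have : α * (α * a * α) * α = α * 1 * α := by rw [h]
      rw [mul_one, hα] at this
      calc a = (α * α) * a * (α * α) := by rw [hα, one_mul, mul_one]
        _ = α * (α * a * α) * α := by group
        _ = 1 := this
    have hcard : 3 ≤ Nat.card (S ⊓ V : Subgroup A) := by
      let f : Fin 3 → (S ⊓ V : Subgroup A) :=
        ![⟨1, (S ⊓ V).one_mem⟩, ⟨a, hx, ha⟩, ⟨α * a * α, hx2, hb⟩]
      have hf : Function.Injective f := by
        intro u v huv
        have huv := congrArg Subtype.val huv
        fin_cases u <;> fin_cases v <;> first | rfl | (exfalso; simp [f] at huv; try tauto)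
      have := Nat.card_le_card_of_injective f hf
      simpa using this
    have h4 : Nat.card (S ⊓ V : Subgroup A) = 4 := by
      have := Nat.le_of_dvd (by norm_num) hdvd
      generalize Nat.card (S ⊓ V : Subgroup A) = n at *
      interval_cases n
      · omega
      · rfl
    have hEq : S ⊓ V = V := Subgroup.eq_of_le_of_card_ge hle (by omega)
    apply hfix
    intro v hv
    have : v ∈ S ⊓ V := hEq.ge hv
    exact this.1

/-- the bound -/
def ff (e : ℕ) : ℕ :=
  ∏ p ∈ (Finset.range (e + 1)).filter Nat.Prime, ∏ k ∈ Finset.range (e + 1), (FF p k * FF p k)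

theorem ff_pos (e : ℕ) : 0 < ff e := by
  apply Finset.prod_pos
  intro p hp
  have hp : p.Prime := (Finset.mem_filter.1 hp).2
  apply Finset.prod_pos
  intro k _
  have : ∀ d, 0 < Fd p k d := fun d => pow_pos (pow_pos hp.pos _) _
  have : 0 < FF p k := Nat.mul_pos (this _) (this _)
  exact Nat.mul_pos this this

theorem main_aux {A : Type} [Group A] (i : A ≃* DihedralGroup 4)
    (V : Subgroup A) (hV4 : Nat.card V = 4)
    (hsq : ∀ v ∈ V, v * v = 1) (α : A) (hα : α * α = 1) (hαV : α ∉ V)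
    {G : Type} [Group G] [Finite G] (φ : A →* MulAut G)
    (hfix : ∀ x : G, (∀ v ∈ V, φ v x = x) → x = 1) (e : ℕ) (he : 0 < e)
    (hexp : ∀ x : G, φ α x = x → x ^ e = 1) (g : G) (hg : g ∈ commutator G) :
    g ^ ff e = 1 := by
  have hA8 : Nat.card A = 8 := by
    rw [Nat.card_congr i.toEquiv, DihedralGroup.nat_card]
  have : Finite A := Nat.finite_of_card_ne_zero (by omega)
  have hV : V.index = 2 := by
    have := V.card_mul_index
    rw [hV4, hA8] at this
    omega
  have hA2 : IsPGroup 2 A := IsPGroup.of_card (n := 3) (by rw [hA8]; norm_num)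
  obtain ⟨D, a, b, hDa, hDb, hDs⟩ := exists_D8S i V hV hV4 hsq α hα hαV φ hfix
  have ho : Odd (Nat.card G) := odd_of_fix (hA2.to_subgroup V) (φ.comp V.subtype)
    (fun x hx => hfix x (fun v hv => hx ⟨v, hv⟩))
  apply orderOf_dvd_iff_pow_eq_one.1
  rw [Nat.dvd_iff_prime_pow_dvd_dvd]
  intro r j hr hj
  rcases Nat.eq_zero_or_pos j with rfl | hj0
  · simp
  have hFr : Fact r.Prime := ⟨hr⟩
  have hr2 : Odd r := ho.of_dvd_nat (((dvd_pow_self r hj0.ne').trans hj).trans (orderOf_dvd_natCard g))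
  obtain ⟨m, hm⟩ := hj
  have hm0 : m ≠ 0 := by
    rintro rfl
    exact (orderOf_pos g).ne' (by rw [hm, mul_zero])
  have hy : orderOf (g ^ m) = r ^ j := by
    rw [orderOf_pow_of_dvd hm0 ⟨_, hm.trans (mul_comm _ _)⟩, hm]
    exact Nat.mul_div_cancel _ (Nat.pos_of_ne_zero hm0)
  obtain ⟨P, hP⟩ := inv_sylow hA2 φ ho r hr
  have hpy : IsPGroup r (Subgroup.zpowers (g ^ m)) :=
    IsPGroup.of_card (n := j) (by rw [Nat.card_zpowers, hy])
  obtain ⟨Q, hQ⟩ := hpy.exists_le_sylow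
  obtain ⟨h, hh⟩ := MulAction.exists_smul_eq G Q P
  have hyP : h * g ^ m * h⁻¹ ∈ P := by
    rw [← hh]
    exact Subgroup.smul_mem_pointwise_smul (g ^ m) (MulAut.conj h) Q.toSubgroup
      (hQ (Subgroup.mem_zpowers _))
  have hyc : h * g ^ m * h⁻¹ ∈ commutator G :=
    (inferInstance : (commutator G).Normal).conj_mem _ (Subgroup.pow_mem _ hg m) h
  obtain ⟨k, e', he', hek⟩ := Nat.exists_eq_pow_mul_and_not_dvd he.ne' r hr.ne_one
  have hq : ∀ c ∈ P.toSubgroup, D.s c = c → c ^ r ^ k = 1 := by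
    intro c hc hsc
    rw [hDs] at hsc
    have h1 := hexp c hsc
    obtain ⟨n, hn⟩ := P.isPGroup' ⟨c, hc⟩
    have hn : c ^ r ^ n = 1 := congrArg Subtype.val hn
    rw [← orderOf_dvd_iff_pow_eq_one] at h1 hn ⊢
    obtain ⟨t, _, ht⟩ := (Nat.dvd_prime_pow hr).1 hn
    rw [hek] at h1
    rw [ht] at h1 ⊢
    exact (Nat.Coprime.pow_left t ((Nat.Prime.coprime_iff_not_dvd hr).2 he')).dvd_of_dvd_mul_right h1
  have hfin := sylow_exp D ho hr2 hr P.toSubgroup P.isPGroup' P.not_dvd_index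
    (fun x hx => by rw [hDa]; exact hP a x hx) (fun x hx => by rw [hDb]; exact hP b x hx)
    (fun x hx => by rw [hDs]; exact hP α x hx) k hq _ hyP hyc
  have hdiv : r ^ j ∣ FF r k * FF r k := by
    rw [← hy, orderOf_dvd_iff_pow_eq_one]
    rw [conj_pow] at hfin
    exact (conj_eq_one_iff).1 hfin
  rcases Nat.eq_zero_or_pos k with rfl | hk
  · have h1 : FF r 0 = 1 := by simp [FF, Fd]
    rw [h1] at hdiv
    exact hdiv.trans (one_dvd _)
  · have h1 : r ^ k ≤ e := Nat.le_of_dvd he ⟨e', hek⟩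
    have h2 : k < r ^ k := Nat.lt_pow_self hr.one_lt
    have h3 : r ≤ r ^ k := Nat.le_self_pow hk.ne' r
    refine hdiv.trans ((Finset.dvd_prod_of_mem (fun k => FF r k * FF r k)
      (Finset.mem_range.2 (by omega : k < e + 1))).trans ?_)
    exact Finset.dvd_prod_of_mem
      (fun p => ∏ k ∈ Finset.range (e + 1), (FF p k * FF p k))
      (Finset.mem_filter.2 ⟨Finset.mem_range.2 (by omega), hr⟩)

end D8P

/-- **Theorem (Romano–Shumyatsky, Theorem 1.4).**
There is a function `f : ℕ → ℕ` such that whenever a group `A` isomorphic to the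
dihedral group `D₈` of order `8`, written `A = V⟨α⟩` with `V` a Klein four-subgroup
and `α` an involution outside `V`, acts by automorphisms on a finite group `G` with
`C_G(V) = 1` and `C_G(α)` of exponent dividing `e > 0`, then the exponent of the
derived subgroup `G'` is at most `f e`. -/
theorem exponent_derived_bounded_of_D8_action :
    ∃ f : ℕ → ℕ,
      ∀ (A : Type) [Group A], Nonempty (A ≃* DihedralGroup 4) →
      ∀ (V : Subgroup A), Nat.card V = 4 → (∀ v ∈ V, v * v = 1) →
      ∀ (α : A), α * α = 1 → α ≠ 1 → α ∉ V →
      ∀ (G : Type) [Group G] [Finite G] (φ : A →* MulAut G),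
        (∀ x : G, (∀ v ∈ V, φ v x = x) → x = 1) →
        ∀ (e : ℕ), 0 < e →
        (∀ x : G, φ α x = x → x ^ e = 1) →
        Monoid.exponent (commutator G) ≤ f e := by
  refine ⟨D8P.ff, ?_⟩
  intro A _ hi V hV4 hsq α hα _ hαV G _ _ φ hfix e he hexp
  obtain ⟨i⟩ := hi
  refine Nat.le_of_dvd (D8P.ff_pos e) (Monoid.exponent_dvd_of_forall_pow_eq_one fun g => ?_)
  exact Subtype.ext (D8P.main_aux i V hV4 hsq α hα hαV φ hfix e he hexp g.1 g.2)
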